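/- arXiv:1602.00929 — 2 statements merged into one kernel-verified Lean document; each statement's English description precedes it below -/
import Mathlib

section
/- Let ω ⊂ ℝ² be open, bounded and connected with smooth boundary and sup_{t∈ω}|t| ≤ d, let E₁ := inf{ ∫_ω|∇v|²dt / ∫_ω|v|²dt : v ∈ C_c^∞(ω), v ≠ 0 }, and assume there exists λ > 0 with ∫_ω|∂_τ v|²dt + ∫_ω|∇v|²dt − E₁∫_ω|v|²dt ≥ λ∫_ω|v|²dt for all v ∈ C_c^∞(ω). Let θ ∈ C_c¹(ℝ) have a bounded second derivative, set θ_m = inf supp θ', θ_M = sup supp θ', let p ∈ (θ_m, θ_M), and suppose there exist p' ∈ ℝ, r > 0 and θ₀ > 0 with (p'−r, p') ⊂ (θ_m, p) and |θ'(s)| ≥ θ₀ on (p'−r, p'). Then for every α > 0 and β > 0 there exists γ_{α,β} > 0 such that for all ψ ∈ C_c^∞((−∞,p)×ω): |2∫_{(θ_m,p)×ω} ∂_sψ · θ'∂_τψ ds dt| ≤ γ_{α,β}·( ∫_{(θ_m,p)×ω}|∇'ψ|² − E₁∫_{(θ_m,p)×ω}|ψ|² ) + α ∫_{(θ_m,p)×ω}|∂_sψ|²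 + β ∫_{(θ_m,p)×ω}|θ'∂_τψ|². -/
open MeasureTheory Real Set

/-- The Hardy weight `ρ` centred at `p`. -/
noncomputable def rho (p : ℝ) (s : ℝ) : ℝ := if s ≤ p then 1 / (1 + (s - p) ^ 2) else 0

/-- Longitudinal derivative `∂_s ψ` at `x = (s, t₂, t₃)`. -/
noncomputable def dS (ψ : ℝ × ℝ × ℝ → ℝ) (x : ℝ × ℝ × ℝ) : ℝ :=
  deriv (fun u => ψ (u, x.2)) x.1

/-- Transverse derivative `∂_{t₂} ψ`. -/
noncomputable def dT2 (ψ : ℝ × ℝ × ℝ → ℝ) (x : ℝ × ℝ × ℝ) : ℝ :=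
  deriv (fun u => ψ (x.1, u, x.2.2)) x.2.1

/-- Transverse derivative `∂_{t₃} ψ`. -/
noncomputable def dT3 (ψ : ℝ × ℝ × ℝ → ℝ) (x : ℝ × ℝ × ℝ) : ℝ :=
  deriv (fun u => ψ (x.1, x.2.1, u)) x.2.2

/-- `|∇'ψ|²`, the squared transverse gradient. -/
noncomputable def gradTsq (ψ : ℝ × ℝ × ℝ → ℝ) (x : ℝ × ℝ × ℝ) : ℝ :=
  (dT2 ψ x) ^ 2 + (dT3 ψ x) ^ 2

/-- The angular derivative `∂_τ ψ = t₂ ∂_{t₃} ψ − t₃ ∂_{t₂} ψ`. -/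
noncomputable def dTau (ψ : ℝ × ℝ × ℝ → ℝ) (x : ℝ × ℝ × ℝ) : ℝ :=
  x.2.1 * dT3 ψ x - x.2.2 * dT2 ψ x

/-- `∂_{t₂} v` for a function on the cross-section. -/
noncomputable def dV2 (v : ℝ × ℝ → ℝ) (t : ℝ × ℝ) : ℝ :=
  deriv (fun u => v (u, t.2)) t.1

/-- `∂_{t₃} v` for a function on the cross-section. -/
noncomputable def dV3 (v : ℝ × ℝ → ℝ) (t : ℝ × ℝ) : ℝ :=
  deriv (fun u => v (t.1, u)) t.2

/-- `|∇v|²` for a function on the cross-section. -/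
noncomputable def gradVsq (v : ℝ × ℝ → ℝ) (t : ℝ × ℝ) : ℝ :=
  (dV2 v t) ^ 2 + (dV3 v t) ^ 2

/-- Angular derivative on the cross-section. -/
noncomputable def dTauV (v : ℝ × ℝ → ℝ) (t : ℝ × ℝ) : ℝ :=
  t.1 * dV3 v t - t.2 * dV2 v t

/-- `v ∈ C_c^∞(ω)`. -/
def TestFun (ω : Set (ℝ × ℝ)) (v : ℝ × ℝ → ℝ) : Prop :=
  ContDiff ℝ (⊤ : ℕ∞) v ∧ HasCompactSupport v ∧ tsupport v ⊆ ω

/-- Admissible functions on `Ω₀ = ℝ × ω`: continuously differentiable on the closure of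
`Ω₀`, square-integrable together with the first partial derivatives, and vanishing on the
Dirichlet part of the boundary, i.e. at `t ∈ ∂ω` for `s ∉ (a, a+l)`. -/
def Admissible (ω : Set (ℝ × ℝ)) (a l : ℝ) (ψ : ℝ × ℝ × ℝ → ℝ) : Prop :=
  ContDiffOn ℝ 1 ψ ((Set.univ : Set ℝ) ×ˢ closure ω) ∧
  IntegrableOn (fun x => (ψ x) ^ 2) ((Set.univ : Set ℝ) ×ˢ ω) ∧
  IntegrableOn (fun x => (dS ψ x) ^ 2) ((Set.univ : Set ℝ) ×ˢ ω) ∧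
  IntegrableOn (fun x => (dT2 ψ x) ^ 2) ((Set.univ : Set ℝ) ×ˢ ω) ∧
  IntegrableOn (fun x => (dT3 ψ x) ^ 2) ((Set.univ : Set ℝ) ×ˢ ω) ∧
  ∀ s t, t ∈ frontier ω → s ∉ Set.Ioo a (a + l) → ψ (s, t) = 0

/-- The potential `g`: zero on the window interval, `E₁` elsewhere. -/
noncomputable def gpot (E₁ a l : ℝ) (s : ℝ) : ℝ := if s ∈ Set.Ioo a (a + l) then 0 else E₁

/-- `ψ ∈ C_c^∞(ℝ × ω)`. -/
def TubeTestFun (ω : Set (ℝ × ℝ)) (ψ : ℝ × ℝ × ℝ → ℝ) : Prop :=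
  ContDiff ℝ (⊤ : ℕ∞) ψ ∧ HasCompactSupport ψ ∧ tsupport ψ ⊆ Set.univ ×ˢ ω

/-- Translation by `h` in the longitudinal variable. -/
def shiftS (h : ℝ) (ψ : ℝ × ℝ × ℝ → ℝ) (x : ℝ × ℝ × ℝ) : ℝ := ψ (x.1 + h, x.2)

/-- The density `|∇'ψ|² - E |ψ|²` of the shifted transverse energy. -/
noncomputable def energyDensity (E : ℝ) (ψ : ℝ × ℝ × ℝ → ℝ) (x : ℝ × ℝ × ℝ) : ℝ :=
  gradTsq ψ x - E * (ψ x) ^ 2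

section PartialDerivatives

variable {ψ φ : ℝ × ℝ × ℝ → ℝ}

lemma hasDerivAt_dS (hψ : Differentiable ℝ ψ) (x : ℝ × ℝ × ℝ) :
    HasDerivAt (fun u => ψ (u, x.2)) (dS ψ x) x.1 :=
  DifferentiableAt.hasDerivAt (by fun_prop)

lemma hasDerivAt_dT2 (hψ : Differentiable ℝ ψ) (x : ℝ × ℝ × ℝ) :
    HasDerivAt (fun u => ψ (x.1, u, x.2.2)) (dT2 ψ x) x.2.1 :=
  DifferentiableAt.hasDerivAt (by fun_prop)

lemma hasDerivAt_dT3 (hψ : Differentiable ℝ ψ) (x : ℝ × ℝ × ℝ) :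
    HasDerivAt (fun u => ψ (x.1, x.2.1, u)) (dT3 ψ x) x.2.2 :=
  DifferentiableAt.hasDerivAt (by fun_prop)

lemma dS_eq_fderiv (hψ : Differentiable ℝ ψ) : dS ψ = fun x => fderiv ℝ ψ x (1, 0, 0) := by
  funext x
  have h : HasDerivAt (fun u : ℝ => (u, x.2)) ((1, 0, 0) : ℝ × ℝ × ℝ) x.1 :=
    (hasDerivAt_id x.1).prodMk (hasDerivAt_const x.1 x.2)
  exact ((hψ (x.1, x.2)).hasFDerivAt.comp_hasDerivAt x.1 h).deriv

lemma dT2_eq_fderiv (hψ : Differentiable ℝ ψ) : dT2 ψ = fun x => fderiv ℝ ψ x (0, 1, 0) := by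
  funext x
  have h : HasDerivAt (fun u : ℝ => (x.1, u, x.2.2)) ((0, 1, 0) : ℝ × ℝ × ℝ) x.2.1 :=
    (hasDerivAt_const _ x.1).prodMk ((hasDerivAt_id x.2.1).prodMk (hasDerivAt_const _ x.2.2))
  exact ((hψ (x.1, x.2.1, x.2.2)).hasFDerivAt.comp_hasDerivAt x.2.1 h).deriv

lemma dT3_eq_fderiv (hψ : Differentiable ℝ ψ) : dT3 ψ = fun x => fderiv ℝ ψ x (0, 0, 1) := by
  funext x
  have h : HasDerivAt (fun u : ℝ => (x.1, x.2.1, u)) ((0, 0, 1) : ℝ × ℝ × ℝ) x.2.2 :=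
    (hasDerivAt_const _ x.1).prodMk ((hasDerivAt_const _ x.2.1).prodMk (hasDerivAt_id x.2.2))
  exact ((hψ (x.1, x.2.1, x.2.2)).hasFDerivAt.comp_hasDerivAt x.2.2 h).deriv

lemma continuous_dS (hψ : ContDiff ℝ 1 ψ) : Continuous (dS ψ) := by
  rw [dS_eq_fderiv (hψ.differentiable one_ne_zero)]
  exact (hψ.continuous_fderiv one_ne_zero).clm_apply continuous_const

lemma continuous_dT2 (hψ : ContDiff ℝ 1 ψ) : Continuous (dT2 ψ) := by
  rw [dT2_eq_fderiv (hψ.differentiable one_ne_zero)]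
  exact (hψ.continuous_fderiv one_ne_zero).clm_apply continuous_const

lemma continuous_dT3 (hψ : ContDiff ℝ 1 ψ) : Continuous (dT3 ψ) := by
  rw [dT3_eq_fderiv (hψ.differentiable one_ne_zero)]
  exact (hψ.continuous_fderiv one_ne_zero).clm_apply continuous_const

lemma continuous_dTau (hψ : ContDiff ℝ 1 ψ) : Continuous (dTau ψ) := by
  have h2 := continuous_dT2 hψ
  have h3 := continuous_dT3 hψ
  unfold dTau
  fun_prop

lemma continuous_energyDensity (E : ℝ) (hψ : ContDiff ℝ 1 ψ) :
    Continuous (energyDensity E ψ) := by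
  have h2 := continuous_dT2 hψ
  have h3 := continuous_dT3 hψ
  have h := hψ.continuous
  unfold energyDensity gradTsq
  fun_prop

lemma dS_of_notMem (hψ : Differentiable ℝ ψ) {x : ℝ × ℝ × ℝ} (hx : x ∉ tsupport ψ) :
    dS ψ x = 0 := by
  simp [dS_eq_fderiv hψ, fderiv_of_notMem_tsupport ℝ hx]

lemma dT2_of_notMem (hψ : Differentiable ℝ ψ) {x : ℝ × ℝ × ℝ} (hx : x ∉ tsupport ψ) :
    dT2 ψ x = 0 := by
  simp [dT2_eq_fderiv hψ, fderiv_of_notMem_tsupport ℝ hx]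

lemma dT3_of_notMem (hψ : Differentiable ℝ ψ) {x : ℝ × ℝ × ℝ} (hx : x ∉ tsupport ψ) :
    dT3 ψ x = 0 := by
  simp [dT3_eq_fderiv hψ, fderiv_of_notMem_tsupport ℝ hx]

lemma dTau_of_notMem (hψ : Differentiable ℝ ψ) {x : ℝ × ℝ × ℝ} (hx : x ∉ tsupport ψ) :
    dTau ψ x = 0 := by
  simp [dTau, dT2_of_notMem hψ hx, dT3_of_notMem hψ hx]

lemma energyDensity_of_notMem (E : ℝ) (hψ : Differentiable ℝ ψ) {x : ℝ × ℝ × ℝ}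
    (hx : x ∉ tsupport ψ) : energyDensity E ψ x = 0 := by
  simp [energyDensity, gradTsq, dT2_of_notMem hψ hx, dT3_of_notMem hψ hx,
    image_eq_zero_of_notMem_tsupport hx]

lemma dT2_mul (hψ : Differentiable ℝ ψ) (hφ : Differentiable ℝ φ) (x : ℝ × ℝ × ℝ) :
    dT2 (fun y => ψ y * φ y) x = dT2 ψ x * φ x + ψ x * dT2 φ x :=
  ((hasDerivAt_dT2 hψ x).mul (hasDerivAt_dT2 hφ x)).deriv

lemma dT3_mul (hψ : Differentiable ℝ ψ) (hφ : Differentiable ℝ φ) (x : ℝ × ℝ × ℝ) :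
    dT3 (fun y => ψ y * φ y) x = dT3 ψ x * φ x + ψ x * dT3 φ x :=
  ((hasDerivAt_dT3 hψ x).mul (hasDerivAt_dT3 hφ x)).deriv

lemma dTau_mul (hψ : Differentiable ℝ ψ) (hφ : Differentiable ℝ φ) (x : ℝ × ℝ × ℝ) :
    dTau (fun y => ψ y * φ y) x = dTau ψ x * φ x + ψ x * dTau φ x := by
  simp only [dTau, dT2_mul hψ hφ, dT3_mul hψ hφ]
  ring

lemma dT2_add (hψ : Differentiable ℝ ψ) (hφ : Differentiable ℝ φ) (x : ℝ × ℝ × ℝ) :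
    dT2 (fun y => ψ y + φ y) x = dT2 ψ x + dT2 φ x :=
  ((hasDerivAt_dT2 hψ x).add (hasDerivAt_dT2 hφ x)).deriv

lemma dT3_add (hψ : Differentiable ℝ ψ) (hφ : Differentiable ℝ φ) (x : ℝ × ℝ × ℝ) :
    dT3 (fun y => ψ y + φ y) x = dT3 ψ x + dT3 φ x :=
  ((hasDerivAt_dT3 hψ x).add (hasDerivAt_dT3 hφ x)).deriv

lemma dT2_sub (hψ : Differentiable ℝ ψ) (hφ : Differentiable ℝ φ) (x : ℝ × ℝ × ℝ) :
    dT2 (fun y => ψ y - φ y) x = dT2 ψ x - dT2 φ x :=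
  ((hasDerivAt_dT2 hψ x).sub (hasDerivAt_dT2 hφ x)).deriv

lemma dT3_sub (hψ : Differentiable ℝ ψ) (hφ : Differentiable ℝ φ) (x : ℝ × ℝ × ℝ) :
    dT3 (fun y => ψ y - φ y) x = dT3 ψ x - dT3 φ x :=
  ((hasDerivAt_dT3 hψ x).sub (hasDerivAt_dT3 hφ x)).deriv

lemma dTau_sub (hψ : Differentiable ℝ ψ) (hφ : Differentiable ℝ φ) (x : ℝ × ℝ × ℝ) :
    dTau (fun y => ψ y - φ y) x = dTau ψ x - dTau φ x := by
  simp only [dTau, dT2_sub hψ hφ, dT3_sub hψ hφ]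
  ring

/-- Parallelogram identity for the energy density. -/
lemma energyDensity_add_add_sub (E : ℝ) (hψ : Differentiable ℝ ψ) (hφ : Differentiable ℝ φ)
    (x : ℝ × ℝ × ℝ) :
    energyDensity E (fun y => ψ y + φ y) x + energyDensity E (fun y => ψ y - φ y) x
      = 2 * energyDensity E ψ x + 2 * energyDensity E φ x := by
  simp only [energyDensity, gradTsq, dT2_add hψ hφ, dT3_add hψ hφ, dT2_sub hψ hφ, dT3_sub hψ hφ]
  ring

end PartialDerivatives

namespace TubeTestFun

variable {ω : Set (ℝ × ℝ)} {ψ φ : ℝ × ℝ × ℝ → ℝ}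

lemma contDiff_one (hψ : TubeTestFun ω ψ) : ContDiff ℝ 1 ψ :=
  hψ.1.of_le (by exact_mod_cast le_top)

lemma differentiable (hψ : TubeTestFun ω ψ) : Differentiable ℝ ψ :=
  hψ.contDiff_one.differentiable one_ne_zero

lemma continuous (hψ : TubeTestFun ω ψ) : Continuous ψ := hψ.1.continuous

lemma integrable_of_notMem (hψ : TubeTestFun ω ψ) {f : ℝ × ℝ × ℝ → ℝ} (hf : Continuous f)
    (h : ∀ x, x ∉ tsupport ψ → f x = 0) : Integrable f :=
  hf.integrable_of_hasCompactSupport (HasCompactSupport.intro hψ.2.1 h)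

lemma integrable_sq (hψ : TubeTestFun ω ψ) : Integrable (fun x => (ψ x) ^ 2) :=
  hψ.integrable_of_notMem (hψ.continuous.pow 2) fun x hx => by
    simp [image_eq_zero_of_notMem_tsupport hx]

lemma integrable_abs (hψ : TubeTestFun ω ψ) : Integrable (fun x => |ψ x|) :=
  hψ.integrable_of_notMem hψ.continuous.abs fun x hx => by
    simp [image_eq_zero_of_notMem_tsupport hx]

lemma integrable_dS_sq (hψ : TubeTestFun ω ψ) : Integrable (fun x => (dS ψ x) ^ 2) :=
  hψ.integrable_of_notMem ((continuous_dS hψ.contDiff_one).pow 2) fun x hx => by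
    simp [dS_of_notMem hψ.differentiable hx]

lemma integrable_dTau (hψ : TubeTestFun ω ψ) : Integrable (dTau ψ) :=
  hψ.integrable_of_notMem (continuous_dTau hψ.contDiff_one) fun x hx => by
    simp [dTau_of_notMem hψ.differentiable hx]

lemma integrable_dTau_sq (hψ : TubeTestFun ω ψ) : Integrable (fun x => (dTau ψ x) ^ 2) :=
  hψ.integrable_of_notMem ((continuous_dTau hψ.contDiff_one).pow 2) fun x hx => by
    simp [dTau_of_notMem hψ.differentiable hx]

lemma integrable_gradTsq (hψ : TubeTestFun ω ψ) : Integrable (gradTsq ψ) :=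
  hψ.integrable_of_notMem
    (((continuous_dT2 hψ.contDiff_one).pow 2).add ((continuous_dT3 hψ.contDiff_one).pow 2))
    fun x hx => by
      simp [gradTsq, dT2_of_notMem hψ.differentiable hx, dT3_of_notMem hψ.differentiable hx]

lemma integrable_energyDensity (E : ℝ) (hψ : TubeTestFun ω ψ) : Integrable (energyDensity E ψ) :=
  hψ.integrable_of_notMem (continuous_energyDensity E hψ.contDiff_one) fun _ hx =>
    energyDensity_of_notMem E hψ.differentiable hx

lemma of_support_subset (hψ : TubeTestFun ω ψ) (hφ : TubeTestFun ω φ) {w : ℝ × ℝ × ℝ → ℝ}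
    (hw : ContDiff ℝ (⊤ : ℕ∞) w) (h : ∀ x, ψ x = 0 → φ x = 0 → w x = 0) : TubeTestFun ω w := by
  have hsub : tsupport w ⊆ tsupport ψ ∪ tsupport φ := by
    refine closure_minimal (fun x hx => ?_)
      ((isClosed_tsupport ψ).union (isClosed_tsupport φ))
    by_contra hn
    rw [mem_union, not_or] at hn
    exact hx (h x (image_eq_zero_of_notMem_tsupport hn.1) (image_eq_zero_of_notMem_tsupport hn.2))
  exact ⟨hw, (hψ.2.1.isCompact.union hφ.2.1.isCompact).of_isClosed_subset (isClosed_tsupport w) hsub,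
    hsub.trans (union_subset hψ.2.2 hφ.2.2)⟩

lemma add (hψ : TubeTestFun ω ψ) (hφ : TubeTestFun ω φ) : TubeTestFun ω (fun x => ψ x + φ x) :=
  hψ.of_support_subset hφ (hψ.1.add hφ.1) fun x h1 h2 => by simp [h1, h2]

lemma sub (hψ : TubeTestFun ω ψ) (hφ : TubeTestFun ω φ) : TubeTestFun ω (fun x => ψ x - φ x) :=
  hψ.of_support_subset hφ (hψ.1.sub hφ.1) fun x h1 h2 => by simp [h1, h2]

lemma mul (hψ : TubeTestFun ω ψ) (hφ : TubeTestFun ω φ) : TubeTestFun ω (fun x => ψ x * φ x) :=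
  hψ.of_support_subset hφ (hψ.1.mul hφ.1) fun x h1 h2 => by simp [h1, h2]

lemma shiftS (hψ : TubeTestFun ω ψ) (h : ℝ) : TubeTestFun ω (shiftS h ψ) := by
  have he : _root_.shiftS h ψ = ψ ∘ (Homeomorph.addRight ((h, 0) : ℝ × (ℝ × ℝ))) := by
    funext x
    simp [_root_.shiftS, Prod.add_def]
  refine ⟨?_, ?_, ?_⟩
  · unfold _root_.shiftS
    exact hψ.1.comp (by fun_prop)
  · rw [he]
    exact hψ.2.1.comp_homeomorph _
  · rw [he]
    intro x hx
    have := hψ.2.2 (tsupport_comp_subset_preimage ψ (Homeomorph.continuous _) hx)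
    simpa using this

/-- The regularised modulus of a pair of test functions is a test function. -/
lemma sqrt_add_sub (hψ : TubeTestFun ω ψ) (hφ : TubeTestFun ω φ) {ε : ℝ} (hε : 0 < ε) :
    TubeTestFun ω (fun x => √(ψ x ^ 2 + φ x ^ 2 + ε ^ 2) - ε) := by
  refine hψ.of_support_subset hφ ?_ fun x h1 h2 => by simp [h1, h2, Real.sqrt_sq hε.le]
  have hpos : ∀ x, ψ x ^ 2 + φ x ^ 2 + ε ^ 2 ≠ 0 := fun x => by positivity
  exact ((((hψ.1.pow 2).add (hφ.1.pow 2)).add contDiff_const).sqrt hpos).sub contDiff_const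

lemma slice (hψ : TubeTestFun ω ψ) (s : ℝ) : TestFun ω (fun t => ψ (s, t)) := by
  have hsub : tsupport (fun t => ψ (s, t)) ⊆ (fun t => (s, t)) ⁻¹' tsupport ψ :=
    tsupport_comp_subset_preimage ψ (f := fun t : ℝ × ℝ => (s, t)) (by fun_prop)
  refine ⟨hψ.1.comp (by fun_prop), ?_, fun t ht => (hψ.2.2 (hsub ht)).2⟩
  refine (hψ.2.1.isCompact.image continuous_snd).of_isClosed_subset (isClosed_tsupport _) ?_
  exact fun t ht => ⟨(s, t), hsub ht, rfl⟩

end TubeTestFun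

section Energy

variable {ω : Set (ℝ × ℝ)} {E : ℝ}

lemma TestFun.hasCompactSupport_sq {v : ℝ × ℝ → ℝ} (hv : TestFun ω v) :
    HasCompactSupport fun t => v t ^ 2 :=
  hv.2.1.comp_left (g := fun y : ℝ => y ^ 2) (by simp)

lemma TestFun.integrable_sq {v : ℝ × ℝ → ℝ} (hv : TestFun ω v) :
    Integrable fun t => v t ^ 2 :=
  (hv.1.continuous.pow 2).integrable_of_hasCompactSupport hv.hasCompactSupport_sq

lemma gradVsq_slice (ψ : ℝ × ℝ × ℝ → ℝ) (s : ℝ) :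
    gradVsq (fun t => ψ (s, t)) = fun t => gradTsq ψ (s, t) := rfl

/-- The shifted energy form is nonnegative on every tube `I × ω`. -/
lemma setIntegral_energyDensity_nonneg
    (hE : ∀ v, TestFun ω v → E * (∫ t in ω, (v t) ^ 2) ≤ ∫ t in ω, gradVsq v t)
    {ψ : ℝ × ℝ × ℝ → ℝ} (hψ : TubeTestFun ω ψ) (I : Set ℝ) :
    0 ≤ ∫ x in I ×ˢ ω, energyDensity E ψ x := by
  rw [Measure.volume_eq_prod, setIntegral_prod _ (hψ.integrable_energyDensity E).integrableOn]
  refine integral_nonneg fun s => ?_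
  have hv := hψ.slice s
  have hg : Integrable (fun t => gradTsq ψ (s, t)) := by
    have hc : Continuous (fun t => gradTsq ψ (s, t)) := by
      have h2 := continuous_dT2 hψ.contDiff_one
      have h3 := continuous_dT3 hψ.contDiff_one
      unfold gradTsq
      fun_prop
    refine hc.integrable_of_hasCompactSupport
      (HasCompactSupport.intro (hψ.2.1.isCompact.image continuous_snd) fun t ht => ?_)
    have hx : (s, t) ∉ tsupport ψ := fun h => ht ⟨_, h, rfl⟩
    simp [gradTsq, dT2_of_notMem hψ.differentiable hx, dT3_of_notMem hψ.differentiable hx]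
  have hs : Integrable (fun t => (ψ (s, t)) ^ 2) := hv.integrable_sq
  have key : (∫ t in ω, energyDensity E ψ (s, t))
      = (∫ t in ω, gradTsq ψ (s, t)) - E * ∫ t in ω, (ψ (s, t)) ^ 2 := by
    rw [← integral_const_mul, ← integral_sub hg.integrableOn (hs.integrableOn.const_mul E)]
    simp only [energyDensity]
  have := hE _ hv
  rw [gradVsq_slice] at this
  simp only [Pi.zero_apply]
  rw [key]
  linarith

/-- The variational characterisation of `E₁` as an infimum of Rayleigh quotients. -/
lemma mul_setIntegral_sq_le_of_eq_sInf
    (hE : E = sInf {r : ℝ | ∃ v : ℝ × ℝ → ℝ, TestFun ω v ∧ v ≠ 0 ∧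
      r = (∫ t in ω, gradVsq v t) / ∫ t in ω, (v t) ^ 2})
    (v : ℝ × ℝ → ℝ) (hv : TestFun ω v) :
    E * (∫ t in ω, (v t) ^ 2) ≤ ∫ t in ω, gradVsq v t := by
  have hgrad : ∀ w : ℝ × ℝ → ℝ, 0 ≤ ∫ t in ω, gradVsq w t := fun w =>
    integral_nonneg fun t => by simp only [gradVsq, Pi.zero_apply]; positivity
  by_cases h0 : v = 0
  · have := hgrad v
    simpa [h0] using this
  have hpos : 0 < ∫ t in ω, (v t) ^ 2 := by
    rw [setIntegral_eq_integral_of_forall_compl_eq_zero fun t ht => by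
      simp [image_eq_zero_of_notMem_tsupport fun h => ht (hv.2.2 h)]]
    obtain ⟨t, ht⟩ := Function.ne_iff.1 h0
    exact (hv.1.continuous.pow 2).integral_pos_of_hasCompactSupport_nonneg_nonzero (x := t)
      hv.hasCompactSupport_sq (fun t => sq_nonneg (v t))
      (pow_ne_zero 2 ht)
  rw [← le_div_iff₀ hpos, hE]
  refine csInf_le ⟨0, ?_⟩ ⟨v, hv, h0, rfl⟩
  rintro _ ⟨w, -, -, rfl⟩
  exact div_nonneg (hgrad w) (integral_nonneg fun t => sq_nonneg (w t))

lemma nonneg_of_eq_sInf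
    (hE : E = sInf {r : ℝ | ∃ v : ℝ × ℝ → ℝ, TestFun ω v ∧ v ≠ 0 ∧
      r = (∫ t in ω, gradVsq v t) / ∫ t in ω, (v t) ^ 2}) : 0 ≤ E := by
  rw [hE]
  refine Real.sInf_nonneg ?_
  rintro _ ⟨w, -, -, rfl⟩
  exact div_nonneg (integral_nonneg fun t => by simp only [gradVsq, Pi.zero_apply]; positivity)
    (integral_nonneg fun t => sq_nonneg (w t))

end Energy

section Angular

instance : (volume : Measure (ℝ × ℝ × ℝ)).IsAddHaarMeasure := by
  have h : (volume : Measure (ℝ × ℝ)).IsAddHaarMeasure :=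
    Measure.prod.instIsAddHaarMeasure volume volume
  exact Measure.prod.instIsAddHaarMeasure volume volume

lemma integral_mul_partial_eq_zero {m f f' : ℝ × ℝ × ℝ → ℝ} {v : ℝ × ℝ × ℝ}
    (hm : ∀ x (u : ℝ), m (x + u • v) = m x)
    (hf : ∀ x, HasLineDerivAt ℝ f (f' x) x v)
    (hi : Integrable fun x => m x * f x) (hi' : Integrable fun x => m x * f' x) :
    ∫ x, m x * f' x = 0 := by
  have h := integral_bilinear_hasLineDerivAt_right_eq_neg_left_of_integrable (μ := volume)
    (f := m) (f' := fun _ => 0) (g := f) (g' := f') (v := v)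
    (B := ContinuousLinearMap.mul ℝ ℝ) (by simp) (by simpa using hi') (by simpa using hi)
    (fun x _ => by
      simp only [HasLineDerivAt, hm]
      exact hasDerivAt_const _ _) (fun x _ => hf x)
  simpa using h

lemma integrable_mul_of_hasCompactSupport {f : ℝ × ℝ × ℝ → ℝ} (hf : Continuous f)
    (hc : HasCompactSupport f) {m : ℝ → ℝ} (hm : Measurable m) {C : ℝ} (hC : ∀ s, |m s| ≤ C) :
    Integrable fun x => m x.1 * f x :=
  (hf.integrable_of_hasCompactSupport hc).bdd_mul
    (hm.comp measurable_fst).aestronglyMeasurable (Filter.Eventually.of_forall fun x => hC x.1)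

/-- The angular derivative of a compactly supported function has zero weighted mean. -/
lemma integral_mul_dTau_eq_zero {ω : Set (ℝ × ℝ)} {f : ℝ × ℝ × ℝ → ℝ} (hf : TubeTestFun ω f)
    {m : ℝ → ℝ} (hm : Measurable m) {C : ℝ} (hC : ∀ s, |m s| ≤ C) :
    ∫ x, m x.1 * dTau f x = 0 := by
  have hd := hf.differentiable
  have hi : ∀ g : ℝ × ℝ × ℝ → ℝ, Continuous g → (∀ x, x ∉ tsupport f → g x = 0) →
      Integrable fun x => m x.1 * g x := fun g hg h0 =>
    integrable_mul_of_hasCompactSupport hg (HasCompactSupport.intro hf.2.1 h0) hm hC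
  have c := hf.continuous
  have c2 := continuous_dT2 hf.contDiff_one
  have c3 := continuous_dT3 hf.contDiff_one
  have i2 := hi (fun x => x.2.2 * dT2 f x) (by fun_prop)
    fun x hx => by simp [dT2_of_notMem hd hx]
  have i3 := hi (fun x => x.2.1 * dT3 f x) (by fun_prop)
    fun x hx => by simp [dT3_of_notMem hd hx]
  have j2 := hi (fun x => x.2.2 * f x) (by fun_prop)
    fun x hx => by simp [image_eq_zero_of_notMem_tsupport hx]
  have j3 := hi (fun x => x.2.1 * f x) (by fun_prop)
    fun x hx => by simp [image_eq_zero_of_notMem_tsupport hx]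
  have e2 : ∫ x, m x.1 * (x.2.2 * dT2 f x) = 0 := by
    simp only [← mul_assoc] at i2 j2 ⊢
    refine integral_mul_partial_eq_zero (v := (0, 1, 0)) (by simp) (fun x => ?_) j2 i2
    rw [dT2_eq_fderiv hd]
    exact (hd x).hasFDerivAt.hasLineDerivAt _
  have e3 : ∫ x, m x.1 * (x.2.1 * dT3 f x) = 0 := by
    simp only [← mul_assoc] at i3 j3 ⊢
    refine integral_mul_partial_eq_zero (v := (0, 0, 1)) (by simp) (fun x => ?_) j3 i3
    rw [dT3_eq_fderiv hd]
    exact (hd x).hasFDerivAt.hasLineDerivAt _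
  simp only [dTau, mul_sub]
  rw [integral_sub i3 i2, e2, e3, sub_zero]

end Angular

section Picone

variable {ω : Set (ℝ × ℝ)} {E : ℝ}

/-- Pointwise form of the Picone-type inequality. Here `R` is the regularised modulus of the pair
`(a, b)` and `t₂`, `t₃` are the components of a vector of sup-norm at most `d`. -/
lemma abs_cross_le {a b a₂ a₃ b₂ b₃ t₂ t₃ d ε κ R : ℝ} (hκ : 0 < κ) (hR : 0 < R)
    (hRsq : R ^ 2 = a ^ 2 + b ^ 2 + ε ^ 2) (h₂ : |t₂| ≤ d) (h₃ : |t₃| ≤ d) :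
    |b * (t₂ * a₃ - t₃ * a₂) - a * (t₂ * b₃ - t₃ * b₂)|
      ≤ κ * ((a₂ ^ 2 + a₃ ^ 2) + (b₂ ^ 2 + b₃ ^ 2)
          - (((a * a₂ + b * b₂) / R) ^ 2 + ((a * a₃ + b * b₃) / R) ^ 2))
        + d ^ 2 / (2 * κ) * (a ^ 2 + b ^ 2 + ε ^ 2) := by
  have aux : ∀ t x y : ℝ, |t| ≤ d → |t * (b * x - a * y)|
      ≤ κ * (x ^ 2 + y ^ 2 - ((a * x + b * y) / R) ^ 2) + d ^ 2 / (4 * κ) * R ^ 2 := by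
    intro t x y ht
    set z := |b * x - a * y| / R with hz
    have hzR : |b * x - a * y| = z * R := by rw [hz]; field_simp
    have hz2 : z ^ 2 ≤ x ^ 2 + y ^ 2 - ((a * x + b * y) / R) ^ 2 := by
      rw [hz, div_pow, div_pow, sq_abs, le_sub_iff_add_le, ← add_div, div_le_iff₀ (by positivity),
        hRsq]
      nlinarith [mul_nonneg (sq_nonneg ε) (add_nonneg (sq_nonneg x) (sq_nonneg y))]
    have h1 : |t * (b * x - a * y)| ≤ d * (z * R) := by
      rw [abs_mul, hzR]
      exact mul_le_mul_of_nonneg_right ht (by positivity)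
    have h2 : d * (z * R) ≤ κ * z ^ 2 + d ^ 2 / (4 * κ) * R ^ 2 := by
      have : κ * z ^ 2 + d ^ 2 / (4 * κ) * R ^ 2 - d * (z * R)
          = (2 * κ * z - d * R) ^ 2 / (4 * κ) := by field_simp; ring
      have : 0 ≤ (2 * κ * z - d * R) ^ 2 / (4 * κ) := by positivity
      linarith
    have h3 := mul_le_mul_of_nonneg_left hz2 hκ.le
    linarith
  have e : b * (t₂ * a₃ - t₃ * a₂) - a * (t₂ * b₃ - t₃ * b₂)
      = t₂ * (b * a₃ - a * b₃) - t₃ * (b * a₂ - a * b₂) := by ring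
  have hs : d ^ 2 / (2 * κ) * (a ^ 2 + b ^ 2 + ε ^ 2) = 2 * (d ^ 2 / (4 * κ) * R ^ 2) := by
    rw [hRsq]; field_simp; ring
  rw [e, hs]
  have := abs_sub (t₂ * (b * a₃ - a * b₃)) (t₃ * (b * a₂ - a * b₂))
  have := aux t₂ a₃ b₃ h₂
  have := aux t₃ a₂ b₂ h₃
  linarith

/-- The gradient of the regularised modulus. -/
lemma gradTsq_sqrt {a b : ℝ × ℝ × ℝ → ℝ} (ha : Differentiable ℝ a) (hb : Differentiable ℝ b)
    {ε : ℝ} (hε : 0 < ε) (x : ℝ × ℝ × ℝ) :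
    gradTsq (fun x => √(a x ^ 2 + b x ^ 2 + ε ^ 2) - ε) x
      = ((a x * dT2 a x + b x * dT2 b x) / √(a x ^ 2 + b x ^ 2 + ε ^ 2)) ^ 2
        + ((a x * dT3 a x + b x * dT3 b x) / √(a x ^ 2 + b x ^ 2 + ε ^ 2)) ^ 2 := by
  have hpos : a x ^ 2 + b x ^ 2 + ε ^ 2 ≠ 0 := by positivity
  have hR : √(a x ^ 2 + b x ^ 2 + ε ^ 2) ≠ 0 := by positivity
  have h2 : dT2 (fun x => √(a x ^ 2 + b x ^ 2 + ε ^ 2) - ε) x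
      = (a x * dT2 a x + b x * dT2 b x) / √(a x ^ 2 + b x ^ 2 + ε ^ 2) := by
    refine HasDerivAt.deriv (((((((hasDerivAt_dT2 ha x).pow 2).add
      ((hasDerivAt_dT2 hb x).pow 2)).add_const (ε ^ 2)).sqrt hpos).sub_const ε).congr_deriv ?_)
    change _ / (2 * √(a x ^ 2 + b x ^ 2 + ε ^ 2)) = _
    rw [div_eq_div_iff (by positivity) hR]
    simp
    ring
  have h3 : dT3 (fun x => √(a x ^ 2 + b x ^ 2 + ε ^ 2) - ε) x
      = (a x * dT3 a x + b x * dT3 b x) / √(a x ^ 2 + b x ^ 2 + ε ^ 2) := by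
    refine HasDerivAt.deriv (((((((hasDerivAt_dT3 ha x).pow 2).add
      ((hasDerivAt_dT3 hb x).pow 2)).add_const (ε ^ 2)).sqrt hpos).sub_const ε).congr_deriv ?_)
    change _ / (2 * √(a x ^ 2 + b x ^ 2 + ε ^ 2)) = _
    rw [div_eq_div_iff (by positivity) hR]
    simp
    ring
  rw [gradTsq, h2, h3]

/-- Picone-type inequality: the antisymmetric angular form of a pair of test functions is
controlled by their energies, because the energy of the modulus of the pair is nonnegative. -/
lemma setIntegral_abs_cross_le
    (hE : ∀ v, TestFun ω v → E * (∫ t in ω, (v t) ^ 2) ≤ ∫ t in ω, gradVsq v t) (hE0 : 0 ≤ E)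
    (hω : MeasurableSet ω) {I : Set ℝ} (hI : MeasurableSet I)
    (hfin : volume (I ×ˢ ω) ≠ ⊤) {d : ℝ} (hd : ∀ t ∈ ω, ‖t‖ ≤ d)
    {a b : ℝ × ℝ × ℝ → ℝ} (ha : TubeTestFun ω a) (hb : TubeTestFun ω b) {κ : ℝ} (hκ : 0 < κ) :
    ∫ x in I ×ˢ ω, |b x * dTau a x - a x * dTau b x|
      ≤ κ * ((∫ x in I ×ˢ ω, energyDensity E a x) + ∫ x in I ×ˢ ω, energyDensity E b x)
        + d ^ 2 / (2 * κ) * ((∫ x in I ×ˢ ω, (a x) ^ 2) + ∫ x in I ×ˢ ω, (b x) ^ 2) := by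
  set X := I ×ˢ ω with hX
  have hXm : MeasurableSet X := hI.prod hω
  have key : ∀ ε > 0, ∫ x in X, |b x * dTau a x - a x * dTau b x|
      ≤ κ * ((∫ x in X, energyDensity E a x) + (∫ x in X, energyDensity E b x)
          + 2 * ε * E * ((∫ x in X, |a x|) + ∫ x in X, |b x|))
        + d ^ 2 / (2 * κ) * ((∫ x in X, (a x) ^ 2) + (∫ x in X, (b x) ^ 2)
          + ε ^ 2 * volume.real X) := by
    intro ε hε
    have hw := ha.sqrt_add_sub hb hε
    set w : ℝ × ℝ × ℝ → ℝ := fun x => √(a x ^ 2 + b x ^ 2 + ε ^ 2) - ε with hwdef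
    have hq := setIntegral_energyDensity_nonneg hE hw I
    have ia := (ha.integrable_energyDensity E).integrableOn (s := X)
    have ib := (hb.integrable_energyDensity E).integrableOn (s := X)
    have iw := (hw.integrable_energyDensity E).integrableOn (s := X)
    have ja := ha.integrable_abs.integrableOn (s := X)
    have jb := hb.integrable_abs.integrableOn (s := X)
    have ka := ha.integrable_sq.integrableOn (s := X)
    have kb := hb.integrable_sq.integrableOn (s := X)
    have iε : IntegrableOn (fun _ : ℝ × ℝ × ℝ => ε ^ 2) X := integrableOn_const hfin
    have il : Integrable (fun x => |b x * dTau a x - a x * dTau b x|) := by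
      have ca := ha.continuous
      have cb := hb.continuous
      have ta := continuous_dTau ha.contDiff_one
      have tb := continuous_dTau hb.contDiff_one
      refine ha.integrable_of_notMem (by fun_prop) fun x hx => ?_
      simp [dTau_of_notMem ha.differentiable hx, image_eq_zero_of_notMem_tsupport hx]
    have i₀ : IntegrableOn (fun x => energyDensity E a x + energyDensity E b x
        - energyDensity E w x) X := (ia.add ib).sub iw
    have j₀ : IntegrableOn (fun x => 2 * ε * E * (|a x| + |b x|)) X := (ja.add jb).const_mul _
    have k₀ : IntegrableOn (fun x => a x ^ 2 + b x ^ 2) X := ka.add kb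
    have i₁ : IntegrableOn (fun x => κ * (energyDensity E a x + energyDensity E b x
        - energyDensity E w x + 2 * ε * E * (|a x| + |b x|))) X := (i₀.add j₀).const_mul κ
    have i₂ : IntegrableOn (fun x => d ^ 2 / (2 * κ) * (a x ^ 2 + b x ^ 2 + ε ^ 2)) X :=
      (k₀.add iε).const_mul _
    have hmono : ∫ x in X, |b x * dTau a x - a x * dTau b x|
        ≤ ∫ x in X, (κ * (energyDensity E a x + energyDensity E b x - energyDensity E w x
            + 2 * ε * E * (|a x| + |b x|)) + d ^ 2 / (2 * κ) * (a x ^ 2 + b x ^ 2 + ε ^ 2)) := by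
      refine setIntegral_mono_on il.integrableOn ?_ hXm fun x hx => ?_
      · exact i₁.add i₂
      have ht : ‖x.2‖ ≤ d := hd _ hx.2
      rw [Prod.norm_def, max_le_iff] at ht
      have hR : 0 < √(a x ^ 2 + b x ^ 2 + ε ^ 2) := Real.sqrt_pos.2 (by positivity)
      have hRsq : √(a x ^ 2 + b x ^ 2 + ε ^ 2) ^ 2 = a x ^ 2 + b x ^ 2 + ε ^ 2 :=
        Real.sq_sqrt (by positivity)
      have hp := abs_cross_le (a₂ := dT2 a x) (a₃ := dT3 a x) (b₂ := dT2 b x) (b₃ := dT3 b x)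
        hκ hR hRsq ht.1 ht.2
      rw [← gradTsq_sqrt ha.differentiable hb.differentiable hε] at hp
      change |b x * dTau a x - a x * dTau b x| ≤ κ * (gradTsq a x + gradTsq b x - gradTsq w x) + _
        at hp
      have hle : √(a x ^ 2 + b x ^ 2 + ε ^ 2) ≤ |a x| + |b x| + ε := by
        rw [Real.sqrt_le_left (by positivity)]
        nlinarith [abs_nonneg (a x), abs_nonneg (b x), sq_abs (a x), sq_abs (b x),
          mul_nonneg (abs_nonneg (a x)) (abs_nonneg (b x)),
          mul_nonneg (abs_nonneg (a x)) hε.le, mul_nonneg (abs_nonneg (b x)) hε.le]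
      have hdens : gradTsq a x + gradTsq b x - gradTsq w x
          ≤ energyDensity E a x + energyDensity E b x - energyDensity E w x
            + 2 * ε * E * (|a x| + |b x|) := by
        have hw2 : w x ^ 2 = a x ^ 2 + b x ^ 2 - 2 * ε * w x := by
          simp only [hwdef]
          linear_combination hRsq
        have hwx : w x ≤ |a x| + |b x| := by simp only [hwdef]; linarith
        have := mul_le_mul_of_nonneg_left hwx (by positivity : 0 ≤ 2 * ε * E)
        simp only [energyDensity]
        rw [hw2]
        linarith
      have := mul_le_mul_of_nonneg_left hdens hκ.le
      linarith
    refine hmono.trans ?_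
    rw [integral_add i₁ i₂, integral_const_mul, integral_const_mul, integral_add i₀ j₀,
      integral_sub (f := fun x => energyDensity E a x + energyDensity E b x) (ia.add ib) iw,
      integral_add ia ib, integral_const_mul, integral_add ja jb,
      integral_add k₀ iε, integral_add ka kb, setIntegral_const, smul_eq_mul,
      mul_comm (volume.real X)]
    have := mul_nonneg hκ.le hq
    linarith
  have hlim : Filter.Tendsto (fun ε : ℝ =>
      κ * ((∫ x in X, energyDensity E a x) + (∫ x in X, energyDensity E b x)
          + 2 * ε * E * ((∫ x in X, |a x|) + ∫ x in X, |b x|))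
        + d ^ 2 / (2 * κ) * ((∫ x in X, (a x) ^ 2) + (∫ x in X, (b x) ^ 2)
          + ε ^ 2 * volume.real X)) (nhdsWithin 0 (Set.Ioi 0)) (nhds
      (κ * ((∫ x in X, energyDensity E a x) + ∫ x in X, energyDensity E b x)
        + d ^ 2 / (2 * κ) * ((∫ x in X, (a x) ^ 2) + ∫ x in X, (b x) ^ 2))) := by
    refine Filter.Tendsto.mono_left (Continuous.tendsto' (by fun_prop) _ _ (by simp))
      nhdsWithin_le_nhds
  exact ge_of_tendsto hlim (Filter.eventually_of_mem self_mem_nhdsWithin key)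

end Picone

section Translation

variable {ω : Set (ℝ × ℝ)}

lemma dTau_shiftS (h : ℝ) (ψ : ℝ × ℝ × ℝ → ℝ) : dTau (shiftS h ψ) = shiftS h (dTau ψ) := rfl

lemma integral_shiftS (h : ℝ) (f : ℝ × ℝ × ℝ → ℝ) : ∫ x, shiftS h f x = ∫ x, f x := by
  rw [← integral_add_right_eq_self f ((h, 0) : ℝ × ℝ × ℝ)]
  simp [shiftS, Prod.add_def]

/-- Translating to the left decreases the integral over a tube which is bounded from the right by
the support of the integrand. -/
lemma setIntegral_shiftS_le (hω : MeasurableSet ω) {f : ℝ × ℝ × ℝ → ℝ} (hf : Integrable f)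
    {c p h : ℝ} (hh : 0 ≤ h) (hp : ∀ x : ℝ × ℝ × ℝ, p ≤ x.1 → f x = 0)
    (hpos : 0 ≤ ∫ x in Ico c (c + h) ×ˢ ω, f x) :
    ∫ x in Ico c p ×ˢ ω, shiftS h f x ≤ ∫ x in Ico c p ×ˢ ω, f x := by
  have hIci : ∀ g : ℝ × ℝ × ℝ → ℝ, (∀ x : ℝ × ℝ × ℝ, p ≤ x.1 → g x = 0) →
      ∫ x in Ico c p ×ˢ ω, g x = ∫ x in Ici c ×ˢ ω, g x := fun g hg =>
    (setIntegral_eq_of_subset_of_forall_sdiff_eq_zero (measurableSet_Ici.prod hω)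
      (prod_mono_left Ico_subset_Ici_self) fun x hx => hg x <| by
        by_contra hn
        exact hx.2 ⟨⟨hx.1.1, not_le.1 hn⟩, hx.1.2⟩).symm
  have hshift : ∫ x in Ici c ×ˢ ω, shiftS h f x = ∫ x in Ici (c + h) ×ˢ ω, f x := by
    rw [← integral_indicator (measurableSet_Ici.prod hω),
      ← integral_indicator (measurableSet_Ici.prod hω),
      ← integral_shiftS h (indicator (Ici (c + h) ×ˢ ω) f)]
    congr 1
    funext x
    have hmem : x ∈ Ici c ×ˢ ω ↔ (x.1 + h, x.2) ∈ Ici (c + h) ×ˢ ω :=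
      and_congr (add_le_add_iff_right h).symm Iff.rfl
    by_cases hx : x ∈ Ici c ×ˢ ω
    · simp only [shiftS, indicator_of_mem hx, indicator_of_mem (hmem.1 hx)]
    · simp only [shiftS, indicator_of_notMem hx, indicator_of_notMem (hx ∘ hmem.2)]
  have hunion : Ici c ×ˢ ω = Ico c (c + h) ×ˢ ω ∪ Ici (c + h) ×ˢ ω := by
    rw [← union_prod, Ico_union_Ici_eq_Ici (by linarith)]
  have hdisj : Disjoint (Ico c (c + h) ×ˢ ω) (Ici (c + h) ×ˢ ω) := by
    rw [Set.disjoint_left]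
    exact fun x hx hx' => absurd hx.1.2 (not_lt.2 hx'.1)
  rw [hIci f hp, hIci (shiftS h f) fun x hx => hp _ (le_add_of_le_of_nonneg hx hh), hshift, hunion,
    setIntegral_union hdisj (measurableSet_Ici.prod hω) hf.integrableOn hf.integrableOn]
  linarith

/-- Cauchy–Schwarz form of the fundamental theorem of calculus. -/
lemma sq_sub_le_mul_integral_sq {f f' : ℝ → ℝ} (hf : ∀ s, HasDerivAt f (f' s) s)
    (hf' : Continuous f') {s s' : ℝ} (hs : s ≤ s') :
    (f s' - f s) ^ 2 ≤ (s' - s) * ∫ u in s..s', (f' u) ^ 2 := by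
  rcases hs.eq_or_lt with rfl | hlt
  · simp
  have hftc : ∫ u in s..s', f' u = f s' - f s :=
    intervalIntegral.integral_eq_sub_of_hasDerivAt (fun u _ => hf u)
      (hf'.intervalIntegrable _ _)
  have hpos : 0 < s' - s := sub_pos.2 hlt
  set c := (f s' - f s) / (s' - s) with hc
  have hnonneg : 0 ≤ ∫ u in s..s', (f' u - c) ^ 2 :=
    intervalIntegral.integral_nonneg hs fun u _ => sq_nonneg _
  have hexp : ∫ u in s..s', (f' u - c) ^ 2
      = (∫ u in s..s', (f' u) ^ 2) - 2 * c * (f s' - f s) + c ^ 2 * (s' - s) := by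
    have e : ∀ u, (f' u - c) ^ 2 = (f' u) ^ 2 - 2 * c * f' u + c ^ 2 := fun u => by ring
    simp only [e]
    rw [intervalIntegral.integral_add, intervalIntegral.integral_sub,
      intervalIntegral.integral_const_mul, hftc, intervalIntegral.integral_const, smul_eq_mul,
      mul_comm (s' - s)]
    all_goals exact Continuous.intervalIntegrable (by fun_prop) _ _
  have hcm : c * (s' - s) = f s' - f s := by rw [hc]; field_simp
  have h2 : (s' - s) * ∫ u in s..s', (f' u - c) ^ 2
      = (s' - s) * (∫ u in s..s', (f' u) ^ 2) - (f s' - f s) ^ 2 := by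
    rw [hexp, ← hcm]
    ring
  have := mul_nonneg hpos.le hnonneg
  linarith

variable {ψ : ℝ × ℝ × ℝ → ℝ} {c p : ℝ}

lemma sq_shiftS_sub_le (hψ : TubeTestFun ω ψ) (hp : tsupport ψ ⊆ Iio p ×ˢ ω) {h : ℝ} (hh : 0 ≤ h)
    {x : ℝ × ℝ × ℝ} (hx : x.1 ∈ Ico c p) :
    (shiftS h ψ x - ψ x) ^ 2 ≤ h * ∫ u in Ico c p, (dS ψ (u, x.2)) ^ 2 := by
  have hcont : Continuous fun u => dS ψ (u, x.2) :=
    (continuous_dS hψ.contDiff_one).comp (by fun_prop)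
  set s' := min (x.1 + h) p with hs'
  have hle : x.1 ≤ s' := le_min (by linarith) hx.2.le
  have hval : ψ (s', x.2) = shiftS h ψ x := by
    rcases le_total (x.1 + h) p with hl | hl
    · rw [hs', min_eq_left hl, shiftS]
    · have h0 : ∀ s, p ≤ s → ψ (s, x.2) = 0 := fun s hs =>
        image_eq_zero_of_notMem_tsupport fun hm => absurd (hp hm).1 (not_lt.2 hs)
      rw [hs', min_eq_right hl, shiftS, h0 _ le_rfl, h0 _ hl]
  have key := sq_sub_le_mul_integral_sq (f := fun u => ψ (u, x.2))
    (fun s => hasDerivAt_dS hψ.differentiable (s, x.2)) hcont hle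
  have hval' : ψ (x.1, x.2) = ψ x := rfl
  simp only [hval, hval'] at key
  refine key.trans ?_
  have hint : ∫ u in x.1..s', (dS ψ (u, x.2)) ^ 2 ≤ ∫ u in Ico c p, (dS ψ (u, x.2)) ^ 2 := by
    rw [intervalIntegral.integral_of_le hle, ← integral_Icc_eq_integral_Ioc,
      integral_Icc_eq_integral_Ico]
    refine setIntegral_mono_set ?_ (Filter.Eventually.of_forall fun u => sq_nonneg _)
      (Ico_subset_Ico hx.1 (min_le_right _ _)).eventuallyLE
    exact ((hcont.pow 2).integrableOn_Icc (a := c) (b := p)).mono_set Ico_subset_Icc_self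
  have h0 : 0 ≤ ∫ u in x.1..s', (dS ψ (u, x.2)) ^ 2 :=
    intervalIntegral.integral_nonneg hle fun u _ => sq_nonneg _
  have hsh : s' - x.1 ≤ h := by
    have := min_le_left (x.1 + h) p
    linarith
  exact mul_le_mul hsh hint h0 hh

/-- Poincaré-type inequality for longitudinal differences. -/
lemma setIntegral_sq_shiftS_sub_le (hω : MeasurableSet ω) (hψ : TubeTestFun ω ψ)
    (hp : tsupport ψ ⊆ Iio p ×ˢ ω) (hcp : c ≤ p) {h : ℝ} (hh : 0 ≤ h) :
    ∫ x in Ico c p ×ˢ ω, (shiftS h ψ x - ψ x) ^ 2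
      ≤ h * (p - c) * ∫ x in Ico c p ×ˢ ω, (dS ψ x) ^ 2 := by
  have hi : Integrable (fun x => (dS ψ x) ^ 2)
      ((volume.restrict (Ico c p)).prod (volume.restrict ω)) := by
    rw [Measure.prod_restrict, ← Measure.volume_eq_prod]
    exact hψ.integrable_dS_sq.integrableOn
  have hg : Integrable (fun x : ℝ × ℝ × ℝ => h * ∫ u in Ico c p, (dS ψ (u, x.2)) ^ 2)
      ((volume.restrict (Ico c p)).prod (volume.restrict ω)) :=
    (hi.integral_prod_right.comp_snd _).const_mul h
  have hmono : ∫ x in Ico c p ×ˢ ω, (shiftS h ψ x - ψ x) ^ 2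
      ≤ ∫ x in Ico c p ×ˢ ω, h * ∫ u in Ico c p, (dS ψ (u, x.2)) ^ 2 := by
    refine setIntegral_mono_on ((hψ.shiftS h).sub hψ).integrable_sq.integrableOn ?_
      (measurableSet_Ico.prod hω) fun x hx => sq_shiftS_sub_le hψ hp hh hx.1
    rwa [IntegrableOn, Measure.volume_eq_prod, ← Measure.prod_restrict]
  refine hmono.trans_eq ?_
  rw [integral_const_mul, Measure.volume_eq_prod, ← Measure.prod_restrict,
    integral_fun_snd (μ := volume.restrict (Ico c p)) (ν := volume.restrict ω)
      (fun t => ∫ u in Ico c p, (dS ψ (u, t)) ^ 2),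
    integral_prod_symm _ hi]
  simp [hcp, mul_assoc]

lemma setIntegral_sq_le (hω : MeasurableSet ω) (hψ : TubeTestFun ω ψ)
    (hp : tsupport ψ ⊆ Iio p ×ˢ ω) (hcp : c ≤ p) :
    ∫ x in Ico c p ×ˢ ω, (ψ x) ^ 2 ≤ (p - c) ^ 2 * ∫ x in Ico c p ×ˢ ω, (dS ψ x) ^ 2 := by
  have h := setIntegral_sq_shiftS_sub_le hω hψ hp hcp (sub_nonneg.2 hcp)
  rw [← sq] at h
  refine le_of_eq_of_le (setIntegral_congr_fun (measurableSet_Ico.prod hω) fun x hx => ?_) h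
  have h0 : ψ (x.1 + (p - c), x.2) = 0 := image_eq_zero_of_notMem_tsupport fun hm => by
    have h1 : x.1 + (p - c) < p := (hp hm).1
    have h2 : c ≤ x.1 := hx.1.1
    linarith
  simp [shiftS, h0]

/-- Differentiation of a longitudinal correlation integral. -/
lemma hasDerivAt_integral_shiftS_neg_mul {m g k : ℝ × ℝ × ℝ → ℝ} (hm : Continuous m)
    (hg : Measurable g) (hk : Integrable k) {B C : ℝ} (hB : ∀ x, |m x| ≤ B) (hC : ∀ x, |g x| ≤ C)
    (hmg : ∀ x, HasDerivAt (fun u => m (u, x.2)) (g x) x.1) (h : ℝ) :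
    HasDerivAt (fun h => ∫ x, m x * shiftS h k x) (-∫ x, g x * shiftS h k x) h := by
  have hrw : ∀ (f : ℝ × ℝ × ℝ → ℝ) (h : ℝ),
      ∫ x, f x * shiftS h k x = ∫ x, f (x.1 - h, x.2) * k x := fun f h => by
    rw [← integral_shiftS h fun x => f (x.1 - h, x.2) * k x]
    simp [shiftS]
  simp only [hrw]
  have hshift : Continuous fun x : ℝ × ℝ × ℝ => ((x.1 - h, x.2) : ℝ × ℝ × ℝ) := by fun_prop
  rw [← integral_neg]
  refine (hasDerivAt_integral_of_dominated_loc_of_deriv_le (bound := fun x => C * |k x|)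
    (F' := fun h x => -(g (x.1 - h, x.2) * k x)) Filter.univ_mem
    (Filter.Eventually.of_forall fun u => ?_) ?_ ?_ ?_ (hk.abs.const_mul C) ?_).2
  · exact (Continuous.aestronglyMeasurable (by fun_prop)).mul hk.aestronglyMeasurable
  · exact hk.bdd_mul (hm.comp hshift).aestronglyMeasurable
      (Filter.Eventually.of_forall fun x => hB _)
  · exact ((hg.comp hshift.measurable).aestronglyMeasurable.mul hk.aestronglyMeasurable).neg
  · refine Filter.Eventually.of_forall fun x u _ => ?_
    rw [norm_neg, norm_mul]
    exact mul_le_mul_of_nonneg_right (hC _) (abs_nonneg _)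
  · refine Filter.Eventually.of_forall fun x u _ => ?_
    have h1 := (hmg (x.1 - u, x.2)).scomp u ((hasDerivAt_id u).const_sub x.1)
    have h2 := h1.mul_const (k x)
    exact h2.congr_deriv (by simp)

end Translation

section Coupling

variable {ω : Set (ℝ × ℝ)} {E c p : ℝ} {ψ : ℝ × ℝ × ℝ → ℝ}

lemma notMem_tsupport_or_lt_of_notMem (hp : tsupport ψ ⊆ Iio p ×ˢ ω) {x : ℝ × ℝ × ℝ}
    (hx : x ∉ Ico c p ×ˢ ω) : x ∉ tsupport ψ ∨ x.1 < c := by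
  by_contra! h
  exact hx ⟨⟨h.2, (hp h.1).1⟩, (hp h.1).2⟩

lemma setIntegral_energyDensity_shiftS_le
    (hE : ∀ v, TestFun ω v → E * (∫ t in ω, (v t) ^ 2) ≤ ∫ t in ω, gradVsq v t)
    (hω : MeasurableSet ω) (hψ : TubeTestFun ω ψ) (hp : tsupport ψ ⊆ Iio p ×ˢ ω)
    {h : ℝ} (hh : 0 ≤ h) :
    ∫ x in Ico c p ×ˢ ω, energyDensity E (shiftS h ψ) x
      ≤ ∫ x in Ico c p ×ˢ ω, energyDensity E ψ x :=
  setIntegral_shiftS_le hω (hψ.integrable_energyDensity E) hh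
    (fun _ hx => energyDensity_of_notMem E hψ.differentiable fun hm => not_lt.2 hx (hp hm).1)
    (setIntegral_energyDensity_nonneg hE hψ _)

lemma setIntegral_shiftS_sq_le (hω : MeasurableSet ω) (hψ : TubeTestFun ω ψ)
    (hp : tsupport ψ ⊆ Iio p ×ˢ ω) {h : ℝ} (hh : 0 ≤ h) :
    ∫ x in Ico c p ×ˢ ω, (shiftS h ψ x) ^ 2 ≤ ∫ x in Ico c p ×ˢ ω, (ψ x) ^ 2 :=
  setIntegral_shiftS_le (f := fun x => (ψ x) ^ 2) hω hψ.integrable_sq hh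
    (fun x hx => by
      simp [image_eq_zero_of_notMem_tsupport fun hm : x ∈ tsupport ψ => not_lt.2 hx (hp hm).1])
    (integral_nonneg fun x => sq_nonneg _)

/-- The angular derivative of a longitudinal difference is controlled by the energy and by a
small multiple of the longitudinal derivative. -/
lemma setIntegral_dTau_shiftS_sub_sq_le
    (hE : ∀ v, TestFun ω v → E * (∫ t in ω, (v t) ^ 2) ≤ ∫ t in ω, gradVsq v t) (hE0 : 0 ≤ E)
    (hω : MeasurableSet ω) {d : ℝ} (hd : ∀ t ∈ ω, ‖t‖ ≤ d)
    (hψ : TubeTestFun ω ψ) (hp : tsupport ψ ⊆ Iio p ×ˢ ω) (hcp : c ≤ p) {h : ℝ} (hh : 0 ≤ h) :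
    ∫ x in Ico c p ×ˢ ω, (dTau (fun y => shiftS h ψ y - ψ y) x) ^ 2
      ≤ 2 * d ^ 2 * (4 * (∫ x in Ico c p ×ˢ ω, energyDensity E ψ x)
          + E * (h * (p - c) * ∫ x in Ico c p ×ˢ ω, (dS ψ x) ^ 2)) := by
  set X := Ico c p ×ˢ ω with hX
  have hXm : MeasurableSet X := measurableSet_Ico.prod hω
  have ha := hψ.shiftS h
  have hχ := ha.sub hψ
  have hs := ha.add hψ
  have h1 : ∫ x in X, (dTau (fun y => shiftS h ψ y - ψ y) x) ^ 2
      ≤ ∫ x in X, 2 * d ^ 2 * (energyDensity E (fun y => shiftS h ψ y - ψ y) x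
          + E * (shiftS h ψ x - ψ x) ^ 2) := by
    refine setIntegral_mono_on hχ.integrable_dTau_sq.integrableOn
      (((hχ.integrable_energyDensity E).integrableOn.add
        (hχ.integrable_sq.integrableOn.const_mul E)).const_mul _) hXm fun x hx => ?_
    have ht : ‖x.2‖ ≤ d := hd _ hx.2
    rw [Prod.norm_def, max_le_iff] at ht
    have t1 := sq_le_sq' (abs_le.1 ht.1).1 (abs_le.1 ht.1).2
    have t2 := sq_le_sq' (abs_le.1 ht.2).1 (abs_le.1 ht.2).2
    simp only [energyDensity, sub_add_cancel, dTau, gradTsq]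
    generalize dT2 (fun y => shiftS h ψ y - ψ y) x = u
    generalize dT3 (fun y => shiftS h ψ y - ψ y) x = v
    nlinarith [sq_nonneg (x.2.1 * u + x.2.2 * v),
      mul_le_mul_of_nonneg_right (add_le_add t1 t2) (add_nonneg (sq_nonneg u) (sq_nonneg v))]
  have h2 : ∫ x in X, 2 * d ^ 2 * (energyDensity E (fun y => shiftS h ψ y - ψ y) x
      + E * (shiftS h ψ x - ψ x) ^ 2)
      = 2 * d ^ 2 * ((∫ x in X, energyDensity E (fun y => shiftS h ψ y - ψ y) x)
          + E * ∫ x in X, (shiftS h ψ x - ψ x) ^ 2) := by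
    rw [integral_const_mul, integral_add (hχ.integrable_energyDensity E).integrableOn
      (hχ.integrable_sq.integrableOn.const_mul E), integral_const_mul]
  have h3 : (∫ x in X, energyDensity E (fun y => shiftS h ψ y + ψ y) x)
      + (∫ x in X, energyDensity E (fun y => shiftS h ψ y - ψ y) x)
      = 2 * (∫ x in X, energyDensity E (shiftS h ψ) x) + 2 * ∫ x in X, energyDensity E ψ x := by
    rw [← integral_add (hs.integrable_energyDensity E).integrableOn
      (hχ.integrable_energyDensity E).integrableOn, ← integral_const_mul, ← integral_const_mul,
      ← integral_add ((ha.integrable_energyDensity E).integrableOn.const_mul 2)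
      ((hψ.integrable_energyDensity E).integrableOn.const_mul 2)]
    simp only [energyDensity_add_add_sub E ha.differentiable hψ.differentiable]
  have h4 := setIntegral_energyDensity_nonneg hE hs (Ico c p)
  have h5 := setIntegral_energyDensity_shiftS_le (c := c) hE hω hψ hp hh
  have h6 := mul_le_mul_of_nonneg_left (setIntegral_sq_shiftS_sub_le hω hψ hp hcp hh) hE0
  rw [← hX] at h4 h5 h6
  rw [h2] at h1
  exact h1.trans (mul_le_mul_of_nonneg_left (by linarith) (by positivity))

/-- The correlation between `ψ` and the angular derivative of a translate is controlled by the
energy and the mass of `ψ`. -/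
lemma abs_integral_mul_dTau_shiftS_le
    (hE : ∀ v, TestFun ω v → E * (∫ t in ω, (v t) ^ 2) ≤ ∫ t in ω, gradVsq v t) (hE0 : 0 ≤ E)
    (hω : MeasurableSet ω) (hfin : volume (Ico c p ×ˢ ω) ≠ ⊤)
    {d : ℝ} (hd : ∀ t ∈ ω, ‖t‖ ≤ d)
    (hψ : TubeTestFun ω ψ) (hp : tsupport ψ ⊆ Iio p ×ˢ ω) {h : ℝ} (hh : 0 ≤ h)
    {m : ℝ → ℝ} (hm : Measurable m) {T : ℝ} (hT : ∀ s, |m s| ≤ T) (hmc : ∀ s < c, m s = 0)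
    {κ : ℝ} (hκ : 0 < κ) :
    2 * |∫ x, m x.1 * ψ x * shiftS h (dTau ψ) x|
      ≤ T * (κ * (2 * ∫ x in Ico c p ×ˢ ω, energyDensity E ψ x)
          + d ^ 2 / (2 * κ) * (2 * ∫ x in Ico c p ×ˢ ω, (ψ x) ^ 2)) := by
  set X := Ico c p ×ˢ ω with hX
  have hT0 : 0 ≤ T := (abs_nonneg _).trans (hT 0)
  have ha := hψ.shiftS h
  have ca := ha.continuous
  have cb := hψ.continuous
  have ta := continuous_dTau ha.contDiff_one
  have tb := continuous_dTau hψ.contDiff_one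
  have hcross : Continuous fun x => ψ x * dTau (shiftS h ψ) x - shiftS h ψ x * dTau ψ x := by
    fun_prop
  have hcross0 : ∀ x, x ∉ tsupport ψ →
      ψ x * dTau (shiftS h ψ) x - shiftS h ψ x * dTau ψ x = 0 := fun x hx => by
    simp [image_eq_zero_of_notMem_tsupport hx, dTau_of_notMem hψ.differentiable hx]
  have i1 : Integrable fun x => m x.1 *
      (ψ x * dTau (shiftS h ψ) x - shiftS h ψ x * dTau ψ x) :=
    integrable_mul_of_hasCompactSupport hcross (HasCompactSupport.intro hψ.2.1 hcross0) hm hT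
  have hab := ha.mul hψ
  have i2 : Integrable fun x => m x.1 * dTau (fun y => shiftS h ψ y * ψ y) x :=
    hab.integrable_dTau.bdd_mul (hm.comp measurable_fst).aestronglyMeasurable
      (Filter.Eventually.of_forall fun x => hT x.1)
  have hsym : 2 * ∫ x, m x.1 * ψ x * shiftS h (dTau ψ) x
      = ∫ x, m x.1 * (ψ x * dTau (shiftS h ψ) x - shiftS h ψ x * dTau ψ x) := by
    rw [← add_zero (∫ x, m x.1 * (ψ x * dTau (shiftS h ψ) x - shiftS h ψ x * dTau ψ x)),
      ← integral_mul_dTau_eq_zero hab hm hT, ← integral_add i1 i2, ← integral_const_mul]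
    congr 1
    funext x
    rw [dTau_mul ha.differentiable hψ.differentiable, dTau_shiftS]
    ring
  have hX0 : ∀ x, x ∉ X →
      |m x.1 * (ψ x * dTau (shiftS h ψ) x - shiftS h ψ x * dTau ψ x)| = 0 := fun x hx => by
    rcases notMem_tsupport_or_lt_of_notMem hp hx with h' | h'
    · rw [hcross0 x h', mul_zero, abs_zero]
    · rw [hmc _ h', zero_mul, abs_zero]
  calc 2 * |∫ x, m x.1 * ψ x * shiftS h (dTau ψ) x|
      = |2 * ∫ x, m x.1 * ψ x * shiftS h (dTau ψ) x| := by rw [abs_mul, abs_two]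
    _ ≤ ∫ x, |m x.1 * (ψ x * dTau (shiftS h ψ) x - shiftS h ψ x * dTau ψ x)| := by
        rw [hsym]
        exact abs_integral_le_integral_abs
    _ = ∫ x in X, |m x.1 * (ψ x * dTau (shiftS h ψ) x - shiftS h ψ x * dTau ψ x)| :=
        (setIntegral_eq_integral_of_forall_compl_eq_zero hX0).symm
    _ ≤ ∫ x in X, T * |ψ x * dTau (shiftS h ψ) x - shiftS h ψ x * dTau ψ x| := by
        refine integral_mono i1.abs.integrableOn
          ((hψ.integrable_of_notMem hcross hcross0).abs.integrableOn.const_mul T) fun x => ?_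
        simp only [abs_mul (m x.1)]
        exact mul_le_mul_of_nonneg_right (hT _) (abs_nonneg _)
    _ = T * ∫ x in X, |ψ x * dTau (shiftS h ψ) x - shiftS h ψ x * dTau ψ x| :=
        integral_const_mul _ _
    _ ≤ _ := by
        refine mul_le_mul_of_nonneg_left ?_ hT0
        refine (setIntegral_abs_cross_le hE hE0 hω measurableSet_Ico hfin hd ha hψ hκ).trans ?_
        have h1 := setIntegral_energyDensity_shiftS_le (c := c) hE hω hψ hp hh
        have h2 := setIntegral_shiftS_sq_le (c := c) hω hψ hp hh
        rw [← hX] at h1 h2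
        exact add_le_add (mul_le_mul_of_nonneg_left (by linarith) hκ.le)
          (mul_le_mul_of_nonneg_left (by linarith) (by positivity))

/-- Weighted Cauchy–Schwarz bound for the pairing of `∂_s(m ψ)` with the angular derivative of a
test function. -/
lemma abs_integral_deriv_mul_dTau_le (hψ : TubeTestFun ω ψ) (hp : tsupport ψ ⊆ Iio p ×ˢ ω)
    {χ : ℝ × ℝ × ℝ → ℝ} (hχ : TubeTestFun ω χ)
    {m : ℝ → ℝ} (hm : Measurable m) {T M : ℝ} (hT : ∀ s, |m s| ≤ T) (hmc : ∀ s < c, m s = 0)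
    (hM : ∀ s, |deriv m s| ≤ M) (hmc' : ∀ s < c, deriv m s = 0) {μ : ℝ} (hμ : 0 < μ) :
    |∫ x, (deriv m x.1 * ψ x + m x.1 * dS ψ x) * dTau χ x|
      ≤ μ * (2 * M ^ 2 * (∫ x in Ico c p ×ˢ ω, (ψ x) ^ 2)
            + 2 * T ^ 2 * ∫ x in Ico c p ×ˢ ω, (dS ψ x) ^ 2)
        + 1 / (4 * μ) * ∫ x in Ico c p ×ˢ ω, (dTau χ x) ^ 2 := by
  set X := Ico c p ×ˢ ω with hX
  have i1 : Integrable fun x => (deriv m x.1 * ψ x + m x.1 * dS ψ x) * dTau χ x := by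
    have cb := hψ.continuous
    have cs := continuous_dS hψ.contDiff_one
    have ct := continuous_dTau hχ.contDiff_one
    have j1 := integrable_mul_of_hasCompactSupport (f := fun x => ψ x * dTau χ x) (by fun_prop)
      (HasCompactSupport.intro hχ.2.1 fun x hx => by simp [dTau_of_notMem hχ.differentiable hx])
      (measurable_deriv m) hM
    have j2 := integrable_mul_of_hasCompactSupport (f := fun x => dS ψ x * dTau χ x) (by fun_prop)
      (HasCompactSupport.intro hχ.2.1 fun x hx => by simp [dTau_of_notMem hχ.differentiable hx])
      hm hT
    refine (j1.add j2).congr (Filter.Eventually.of_forall fun x => ?_)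
    simp only [Pi.add_apply]
    ring
  have hX0 : ∀ x, x ∉ X → |(deriv m x.1 * ψ x + m x.1 * dS ψ x) * dTau χ x| = 0 := fun x hx => by
    rcases notMem_tsupport_or_lt_of_notMem hp hx with h' | h'
    · simp [image_eq_zero_of_notMem_tsupport h', dS_of_notMem hψ.differentiable h']
    · simp [hmc _ h', hmc' _ h']
  have k1 : IntegrableOn (fun x => 2 * M ^ 2 * (ψ x) ^ 2) X :=
    hψ.integrable_sq.integrableOn.const_mul _
  have k2 : IntegrableOn (fun x => 2 * T ^ 2 * (dS ψ x) ^ 2) X :=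
    hψ.integrable_dS_sq.integrableOn.const_mul _
  have k3 : IntegrableOn (fun x => 1 / (4 * μ) * (dTau χ x) ^ 2) X :=
    hχ.integrable_dTau_sq.integrableOn.const_mul _
  have k4 : IntegrableOn (fun x => μ * (2 * M ^ 2 * (ψ x) ^ 2 + 2 * T ^ 2 * (dS ψ x) ^ 2)) X :=
    (k1.add k2).const_mul μ
  calc |∫ x, (deriv m x.1 * ψ x + m x.1 * dS ψ x) * dTau χ x|
      ≤ ∫ x, |(deriv m x.1 * ψ x + m x.1 * dS ψ x) * dTau χ x| := abs_integral_le_integral_abs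
    _ = ∫ x in X, |(deriv m x.1 * ψ x + m x.1 * dS ψ x) * dTau χ x| :=
        (setIntegral_eq_integral_of_forall_compl_eq_zero hX0).symm
    _ ≤ ∫ x in X, (μ * (2 * M ^ 2 * (ψ x) ^ 2 + 2 * T ^ 2 * (dS ψ x) ^ 2)
          + 1 / (4 * μ) * (dTau χ x) ^ 2) := by
        refine integral_mono i1.abs.integrableOn (k4.add k3) fun x => ?_
        have hm2 : m x.1 ^ 2 ≤ T ^ 2 := sq_le_sq' (abs_le.1 (hT x.1)).1 (abs_le.1 (hT x.1)).2
        have hd2 : deriv m x.1 ^ 2 ≤ M ^ 2 :=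
          sq_le_sq' (abs_le.1 (hM x.1)).1 (abs_le.1 (hM x.1)).2
        simp only [abs_mul _ (dTau χ x)]
        set g := deriv m x.1 * ψ x + m x.1 * dS ψ x with hg
        have hg2 : g ^ 2 ≤ 2 * M ^ 2 * (ψ x) ^ 2 + 2 * T ^ 2 * (dS ψ x) ^ 2 := by
          nlinarith [sq_nonneg (deriv m x.1 * ψ x - m x.1 * dS ψ x),
            mul_le_mul_of_nonneg_right hm2 (sq_nonneg (dS ψ x)),
            mul_le_mul_of_nonneg_right hd2 (sq_nonneg (ψ x))]
        have hyoung : |g| * |dTau χ x| ≤ μ * g ^ 2 + 1 / (4 * μ) * (dTau χ x) ^ 2 := by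
          have e : μ * g ^ 2 + 1 / (4 * μ) * (dTau χ x) ^ 2 - |g| * |dTau χ x|
              = (2 * μ * |g| - |dTau χ x|) ^ 2 / (4 * μ) := by
            rw [← sq_abs g, ← sq_abs (dTau χ x)]
            field_simp
            ring
          have : 0 ≤ (2 * μ * |g| - |dTau χ x|) ^ 2 / (4 * μ) := by positivity
          linarith
        have := mul_le_mul_of_nonneg_left hg2 hμ.le
        linarith
    _ = _ := by
        rw [integral_add k4 k3, integral_const_mul, integral_add k1 k2, integral_const_mul,
          integral_const_mul, integral_const_mul]

/-- Quantitative bound for the mixed term, with free parameters `κ`, `μ`, `σ`. -/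
lemma abs_two_mul_setIntegral_dS_mul_dTau_le
    (hE : ∀ v, TestFun ω v → E * (∫ t in ω, (v t) ^ 2) ≤ ∫ t in ω, gradVsq v t) (hE0 : 0 ≤ E)
    (hω : MeasurableSet ω) (hfin : volume (Ico c p ×ˢ ω) ≠ ⊤)
    {d : ℝ} (hd : ∀ t ∈ ω, ‖t‖ ≤ d) (hcp : c ≤ p)
    (hψ : TubeTestFun ω ψ) (hp : tsupport ψ ⊆ Iio p ×ˢ ω)
    {m : ℝ → ℝ} (hm : Differentiable ℝ m) {T M : ℝ} (hT : ∀ s, |m s| ≤ T)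
    (hmc : ∀ s < c, m s = 0) (hM : ∀ s, |deriv m s| ≤ M) (hmc' : ∀ s < c, deriv m s = 0)
    {κ μ σ : ℝ} (hκ : 0 < κ) (hμ : 0 < μ) (hσ : 0 < σ) :
    |2 * ∫ x in Ico c p ×ˢ ω, dS ψ x * (m x.1 * dTau ψ x)|
      ≤ (2 * T * κ / σ + 4 * d ^ 2 / μ) * (∫ x in Ico c p ×ˢ ω, energyDensity E ψ x)
        + (T * d ^ 2 * (p - c) ^ 2 / σ / κ + 4 * (M ^ 2 * (p - c) ^ 2 + T ^ 2) * μ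
            + d ^ 2 * E * (p - c) / μ * σ) * ∫ x in Ico c p ×ˢ ω, (dS ψ x) ^ 2 := by
  set X := Ico c p ×ˢ ω with hX
  set Q := ∫ x in X, energyDensity E ψ x with hQ
  set S := ∫ x in X, (dS ψ x) ^ 2 with hS
  set P := ∫ x in X, (ψ x) ^ 2 with hP
  have hPS : P ≤ (p - c) ^ 2 * S := setIntegral_sq_le hω hψ hp hcp
  have hS0 : 0 ≤ S := integral_nonneg fun x => sq_nonneg _
  have hT0 : 0 ≤ T := (abs_nonneg _).trans (hT 0)
  have hmm := hm.continuous.measurable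
  have cb := hψ.continuous
  have cs := continuous_dS hψ.contDiff_one
  have ct := continuous_dTau hψ.contDiff_one
  set g : ℝ × ℝ × ℝ → ℝ := fun x => deriv m x.1 * ψ x + m x.1 * dS ψ x with hg
  obtain ⟨B, hB⟩ := hψ.2.1.exists_bound_of_continuous cb
  obtain ⟨B', hB'⟩ := (HasCompactSupport.intro hψ.2.1 fun x hx =>
    dS_of_notMem hψ.differentiable hx).exists_bound_of_continuous cs
  have hM0 : 0 ≤ M := (abs_nonneg _).trans (hM 0)
  have hgm : Measurable g :=
    (((measurable_deriv m).comp measurable_fst).mul cb.measurable).add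
      ((hmm.comp measurable_fst).mul cs.measurable)
  have hderiv := hasDerivAt_integral_shiftS_neg_mul (m := fun x => m x.1 * ψ x) (g := g)
    (k := dTau ψ) ((hm.continuous.comp continuous_fst).mul cb) hgm hψ.integrable_dTau
    (B := T * B) (C := M * B + T * B')
    (fun x => by
      rw [abs_mul]
      exact mul_le_mul (hT _) (hB x) (abs_nonneg _) hT0)
    (fun x => by
      refine (abs_add_le _ _).trans ?_
      rw [abs_mul, abs_mul]
      exact add_le_add (mul_le_mul (hM _) (hB x) (abs_nonneg _) hM0)
        (mul_le_mul (hT _) (hB' x) (abs_nonneg _) hT0))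
    (fun x => (hm x.1).hasDerivAt.mul (hasDerivAt_dS hψ.differentiable x))
  have hshift0 : ∀ f : ℝ × ℝ × ℝ → ℝ, shiftS 0 f = f := fun f => by
    funext x
    simp [shiftS]
  have hψψ := hψ.mul hψ
  have hself : ∀ x, dTau (fun y => ψ y * ψ y) x = 2 * (ψ x * dTau ψ x) := fun x => by
    rw [dTau_mul hψ.differentiable hψ.differentiable]
    ring
  have hG0 : ∫ x, m x.1 * ψ x * dTau ψ x = 0 := by
    have h := integral_mul_dTau_eq_zero hψψ hmm hT
    simp only [hself, mul_left_comm _ (2 : ℝ), integral_const_mul] at h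
    simpa [mul_assoc] using h
  have hθ0 : ∫ x, deriv m x.1 * (ψ x * dTau ψ x) = 0 := by
    have h := integral_mul_dTau_eq_zero hψψ (measurable_deriv m) hM
    simp only [hself, mul_left_comm _ (2 : ℝ), integral_const_mul] at h
    simpa using h
  have hψc : ∀ f : ℝ × ℝ × ℝ → ℝ, HasCompactSupport fun x => f x * dTau ψ x := fun f =>
    HasCompactSupport.intro hψ.2.1 fun x hx => by simp [dTau_of_notMem hψ.differentiable hx]
  have j1 : Integrable fun x => deriv m x.1 * (ψ x * dTau ψ x) :=
    integrable_mul_of_hasCompactSupport (by fun_prop) (hψc _) (measurable_deriv m) hM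
  have j2 : Integrable fun x => m x.1 * (dS ψ x * dTau ψ x) :=
    integrable_mul_of_hasCompactSupport (by fun_prop) (hψc _) hmm hT
  have hmain : ∫ x, g x * dTau ψ x = ∫ x in X, dS ψ x * (m x.1 * dTau ψ x) := by
    rw [setIntegral_eq_integral_of_forall_compl_eq_zero fun x hx => ?_]
    · have : (fun x => g x * dTau ψ x)
          = fun x => deriv m x.1 * (ψ x * dTau ψ x) + m x.1 * (dS ψ x * dTau ψ x) := by
        funext x
        simp only [hg]
        ring
      rw [this, integral_add j1 j2, hθ0, zero_add]
      simp only [mul_left_comm]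
    · rcases notMem_tsupport_or_lt_of_notMem hp hx with h' | h'
      · simp [dS_of_notMem hψ.differentiable h']
      · simp [hmc _ h']
  obtain ⟨ξ, hξ, hslope⟩ := exists_hasDerivAt_eq_slope _ _ hσ
    (fun h _ => (hderiv h).continuousAt.continuousWithinAt) (fun h _ => hderiv h)
  simp only [hshift0, hG0, sub_zero] at hslope
  have hχ := (hψ.shiftS ξ).sub hψ
  have hint : ∀ h, Integrable fun x => g x * shiftS h (dTau ψ) x := fun h => by
    have ca := continuous_dTau (hψ.shiftS h).contDiff_one
    rw [dTau_shiftS] at ca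
    have k1 := integrable_mul_of_hasCompactSupport (f := fun x => ψ x * shiftS h (dTau ψ) x)
      (by fun_prop) (HasCompactSupport.intro hψ.2.1 fun x hx => by
        simp [image_eq_zero_of_notMem_tsupport hx]) (measurable_deriv m) hM
    have k2 := integrable_mul_of_hasCompactSupport (f := fun x => dS ψ x * shiftS h (dTau ψ) x)
      (by fun_prop) (HasCompactSupport.intro hψ.2.1 fun x hx => by
        simp [dS_of_notMem hψ.differentiable hx]) hmm hT
    refine (k1.add k2).congr (Filter.Eventually.of_forall fun x => ?_)
    simp only [Pi.add_apply, hg]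
    ring
  have hdiff : ∫ x, g x * dTau (fun y => shiftS ξ ψ y - ψ y) x
      = (∫ x, g x * shiftS ξ (dTau ψ) x) - ∫ x, g x * dTau ψ x := by
    have h0 := hint 0
    rw [hshift0] at h0
    rw [← integral_sub (hint ξ) h0]
    simp only [dTau_sub (hψ.shiftS ξ).differentiable hψ.differentiable, dTau_shiftS, mul_sub]
  have hcorr := abs_integral_mul_dTau_shiftS_le hE hE0 hω hfin hd hψ hp hσ.le hmm hT hmc hκ
  have hrem := abs_integral_deriv_mul_dTau_le hψ hp hχ hmm hT hmc hM hmc' hμ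
  have hτ := setIntegral_dTau_shiftS_sub_sq_le hE hE0 hω hd hψ hp hcp hξ.1.le
  rw [← hX, ← hQ, ← hP] at hcorr
  rw [← hX, ← hP, ← hS] at hrem
  rw [← hX, ← hQ, ← hS] at hτ
  rw [← hmain]
  set K := ∫ x, m x.1 * ψ x * shiftS σ (dTau ψ) x
  set J := ∫ x, g x * dTau ψ x
  set R := ∫ x, g x * dTau (fun y => shiftS ξ ψ y - ψ y) x with hR
  set Z := ∫ x in X, (dTau (fun y => shiftS ξ ψ y - ψ y) x) ^ 2
  have hJ : J = -(K / σ) - R := by linarith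
  have hL : 0 ≤ p - c := sub_nonneg.2 hcp
  have hZ : Z ≤ 2 * d ^ 2 * (4 * Q + E * (σ * (p - c) * S)) := hτ.trans <| by
    have := hξ.2.le
    gcongr
  have hK2 : 2 * |K| ≤ T * (κ * (2 * Q) + d ^ 2 / (2 * κ) * (2 * ((p - c) ^ 2 * S))) :=
    hcorr.trans (by gcongr)
  have hR2 : |R| ≤ μ * (2 * M ^ 2 * ((p - c) ^ 2 * S) + 2 * T ^ 2 * S)
      + 1 / (4 * μ) * (2 * d ^ 2 * (4 * Q + E * (σ * (p - c) * S))) :=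
    hrem.trans (by gcongr)
  have habs : |2 * J| ≤ 2 * |K| / σ + 2 * |R| := by
    rw [hJ, abs_mul, abs_two]
    have := abs_sub (-(K / σ)) R
    rw [abs_neg, abs_div, abs_of_pos hσ] at this
    have e : 2 * |K| / σ = 2 * (|K| / σ) := by ring
    linarith
  have hKσ := div_le_div_of_nonneg_right hK2 hσ.le
  calc |2 * J| ≤ 2 * |K| / σ + 2 * |R| := habs
    _ ≤ T * (κ * (2 * Q) + d ^ 2 / (2 * κ) * (2 * ((p - c) ^ 2 * S))) / σ
        + 2 * (μ * (2 * M ^ 2 * ((p - c) ^ 2 * S) + 2 * T ^ 2 * S)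
      + 1 / (4 * μ) * (2 * d ^ 2 * (4 * Q + E * (σ * (p - c) * S)))) := by linarith
    _ = _ := by
      field_simp
      ring

end Coupling

theorem stmt_12 (ω : Set (ℝ × ℝ)) (hω_open : IsOpen ω) (hω_bdd : Bornology.IsBounded ω)
    (hω_conn : IsConnected ω)
    (d : ℝ) (hd : ∀ t ∈ ω, ‖t‖ ≤ d)
    (E₁ : ℝ)
    (hE₁ : E₁ = sInf {r : ℝ | ∃ v : ℝ × ℝ → ℝ, TestFun ω v ∧ v ≠ 0 ∧
      r = (∫ t in ω, gradVsq v t) / ∫ t in ω, (v t) ^ 2})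
    (lam : ℝ) (hlam : 0 < lam)
    (hGap : ∀ v : ℝ × ℝ → ℝ, TestFun ω v →
      (∫ t in ω, (dTauV v t) ^ 2) + (∫ t in ω, gradVsq v t) - E₁ * (∫ t in ω, (v t) ^ 2)
        ≥ lam * ∫ t in ω, (v t) ^ 2)
    (θ : ℝ → ℝ) (hθ : ContDiff ℝ 1 θ) (hθc : HasCompactSupport θ)
    (hθ'' : Differentiable ℝ (deriv θ)) (M : ℝ) (hM : ∀ s, |deriv (deriv θ) s| ≤ M)
    (θm θM : ℝ) (hθm : θm = sInf (tsupport (deriv θ))) (hθM : θM = sSup (tsupport (deriv θ)))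
    (p : ℝ) (hp : p ∈ Set.Ioo θm θM)
    (p' r θ₀ : ℝ) (hr : 0 < r) (hθ₀ : 0 < θ₀)
    (hsub : Set.Ioo (p' - r) p' ⊆ Set.Ioo θm p)
    (hlb : ∀ s ∈ Set.Ioo (p' - r) p', θ₀ ≤ |deriv θ s|) :
    ∀ α > (0 : ℝ), ∀ β > (0 : ℝ), ∃ γ > (0 : ℝ),
      ∀ ψ : ℝ × ℝ × ℝ → ℝ, ContDiff ℝ (⊤ : ℕ∞) ψ → HasCompactSupport ψ →
        tsupport ψ ⊆ Set.Iio p ×ˢ ω →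
        |2 * ∫ x in Set.Ioo θm p ×ˢ ω, dS ψ x * (deriv θ x.1 * dTau ψ x)|
          ≤ γ * ((∫ x in Set.Ioo θm p ×ˢ ω, gradTsq ψ x)
                - E₁ * ∫ x in Set.Ioo θm p ×ˢ ω, (ψ x) ^ 2)
            + α * (∫ x in Set.Ioo θm p ×ˢ ω, (dS ψ x) ^ 2)
            + β * ∫ x in Set.Ioo θm p ×ˢ ω, (deriv θ x.1 * dTau ψ x) ^ 2 := by
  intro α hα β hβ
  have hcp : θm ≤ p := hp.1.le
  have hm_cs : HasCompactSupport (deriv θ) := hθc.deriv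
  obtain ⟨T, hT⟩ := hm_cs.exists_bound_of_continuous hθ''.continuous
  have hnotMem : ∀ s < θm, s ∉ tsupport (deriv θ) := fun s hs hmem =>
    not_le.2 hs (hθm ▸ csInf_le hm_cs.isCompact.bddBelow hmem)
  have hmc : ∀ s < θm, deriv θ s = 0 := fun s hs =>
    image_eq_zero_of_notMem_tsupport (hnotMem s hs)
  have hmc' : ∀ s < θm, deriv (deriv θ) s = 0 := fun s hs =>
    image_eq_zero_of_notMem_tsupport fun hmem => hnotMem s hs (tsupport_deriv_subset hmem)
  have hE := mul_setIntegral_sq_le_of_eq_sInf hE₁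
  have hE0 := nonneg_of_eq_sInf hE₁
  have hfin : volume (Ico θm p ×ˢ ω) ≠ ⊤ :=
    ((Metric.isBounded_Ico θm p).prod hω_bdd).measure_lt_top.ne
  have hT0 : 0 ≤ T := (norm_nonneg _).trans (hT 0)
  have hL : 0 ≤ p - θm := sub_nonneg.2 hcp
  have hsmall : ∀ A : ℝ, 0 ≤ A → ∃ η > 0, A * η ≤ α / 3 := fun A hA => by
    refine ⟨α / (3 * (A + 1)), by positivity, ?_⟩
    rw [mul_div_assoc', div_le_div_iff₀ (by positivity) (by positivity)]
    nlinarith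
  obtain ⟨μ, hμ, hμα⟩ := hsmall (4 * (M ^ 2 * (p - θm) ^ 2 + T ^ 2)) (by positivity)
  obtain ⟨σ, hσ, hσα⟩ := hsmall (d ^ 2 * E₁ * (p - θm) / μ) (by positivity)
  obtain ⟨κ, hκ, hκα⟩ := hsmall (T * d ^ 2 * (p - θm) ^ 2 / σ) (by positivity)
  refine ⟨2 * T * κ⁻¹ / σ + 4 * d ^ 2 / μ + 1, by positivity, fun ψ hψ hψc hψp => ?_⟩
  have hψt : TubeTestFun ω ψ := ⟨hψ, hψc, fun x hx => ⟨mem_univ _, (hψp hx).2⟩⟩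
  have hset : (Ioo θm p ×ˢ ω : Set (ℝ × ℝ × ℝ)) =ᵐ[volume] Ico θm p ×ˢ ω :=
    Measure.set_prod_ae_eq Ioo_ae_eq_Ico (ae_eq_refl ω)
  simp only [setIntegral_congr_set hset]
  have hbound := abs_two_mul_setIntegral_dS_mul_dTau_le hE hE0 hω_open.measurableSet hfin hd hcp
    hψt hψp hθ'' hT hmc hM hmc' (inv_pos.2 hκ) hμ hσ
  have hQ0 := setIntegral_energyDensity_nonneg hE hψt (Ico θm p)
  have hQ : ∫ x in Ico θm p ×ˢ ω, energyDensity E₁ ψ x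
      = (∫ x in Ico θm p ×ˢ ω, gradTsq ψ x) - E₁ * ∫ x in Ico θm p ×ˢ ω, (ψ x) ^ 2 := by
    rw [← integral_const_mul, ← integral_sub hψt.integrable_gradTsq.integrableOn
      (hψt.integrable_sq.integrableOn.const_mul E₁)]
    rfl
  have hS0 : 0 ≤ ∫ x in Ico θm p ×ˢ ω, (dS ψ x) ^ 2 := integral_nonneg fun x => sq_nonneg _
  have hB0 : 0 ≤ β * ∫ x in Ico θm p ×ˢ ω, (deriv θ x.1 * dTau ψ x) ^ 2 :=
    mul_nonneg hβ.le (integral_nonneg fun x => sq_nonneg _)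
  rw [← hQ]
  rw [div_inv_eq_mul] at hbound
  have hα_le := mul_le_mul_of_nonneg_right
    (show T * d ^ 2 * (p - θm) ^ 2 / σ * κ + 4 * (M ^ 2 * (p - θm) ^ 2 + T ^ 2) * μ
      + d ^ 2 * E₁ * (p - θm) / μ * σ ≤ α by linarith) hS0
  linarith
end

section
/- Let ω ⊂ ℝ² be open, bounded and connected with smooth boundary, let E₁ > 0 satisfy the Poincaré inequality ∫_ω|∇v|²dt ≥ E₁∫_ω|v|²dt for every v ∈ C_c^∞(ω), let θ ∈ C_c¹(ℝ) with θ_m = inf supp θ' and θ_M = sup supp θ', let a ≥ θ_M and p ∈ (θ_m, θ_M). Assume hypotheses (i) and (ii): (i) there is C > 0 such that for every admissible ψ, ∫_{Ω₀}|∇'ψ|² + ∫_{Ω₀}|∂_sψ + θ'∂_τψ|² − ∫_{Ω₀} g(s)|ψ|² ≥ C∫_{Ω₀} ρ(s)|ψ|², where g(s) = 0 on (a,a+l) and g(s) = E₁ elsewhere; (ii) there is γ ∈ (0,1] such that for every admissible ψ, |2∫_{(θ_m,θ_M)×ω} ∂_sψ·θ'∂_τψ| ≤ γ(∫_{(θ_m,θ_M)×ω}|∇'ψ|²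 − E₁∫_{(θ_m,θ_M)×ω}|ψ|²) + (1/2)∫_{(θ_m,θ_M)×ω}|∂_sψ|² + (1/2)∫_{(θ_m,θ_M)×ω}|θ'∂_τψ|². Set K := 1/(πC) + (4 ln 2)/π + (a − p) and l_max := −K + √(K² + 1/(4E₁)). Then for every 0 < l ≤ l_max and every admissible ψ, ∫_{Ω₀}( |∇'ψ|² + |∂_sψ + θ'∂_τψ|² ) ds dt − E₁ ∫_{Ω₀} |ψ|² ds dt ≥ 0. -/
open MeasureTheory Real Set

/-- A `C¹` truncation: it kills `[-ε, ε]`, is `1`-Lipschitz and stays within `4ε` of the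
identity. -/
lemma exists_contDiff_truncation {ε : ℝ} (hε : 0 < ε) :
    ∃ T : ℝ → ℝ, ContDiff ℝ 1 T ∧ (∀ x, |x| ≤ ε → T x = 0) ∧ (∀ x, |deriv T x| ≤ 1) ∧
      ∀ x, |T x - x| ≤ 4 * ε := by
  set c : ℝ → ℝ := fun y => max 0 (min 1 (|y| / ε - 1)) with hc
  have hc_cont : Continuous c := by fun_prop
  have hc0 : ∀ y, 0 ≤ c y := fun y => le_max_left _ _
  have hc1 : ∀ y, c y ≤ 1 := fun y => max_le zero_le_one (min_le_left _ _)
  have hc_zero : ∀ y, |y| ≤ ε → c y = 0 := fun y hy => by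
    have : |y| / ε ≤ 1 := (div_le_one hε).2 hy
    exact max_eq_left ((min_le_right _ _).trans (by linarith))
  have hc_one : ∀ y, 2 * ε < |y| → c y = 1 := fun y hy => by
    have : 2 ≤ |y| / ε := (le_div_iff₀ hε).2 hy.le
    simp only [hc]
    rw [min_eq_left (by linarith), max_eq_right zero_le_one]
  have hderiv : ∀ x, HasDerivAt (fun u => ∫ y in (0 : ℝ)..u, c y) (c x) x := fun x =>
    hc_cont.integral_hasStrictDerivAt 0 x |>.hasDerivAt
  have hderiv_eq : deriv (fun u => ∫ y in (0 : ℝ)..u, c y) = c := funext fun x => (hderiv x).deriv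
  refine ⟨fun u => ∫ y in (0 : ℝ)..u, c y, ?_, fun x hx => ?_, fun x => ?_, fun x => ?_⟩
  · rw [contDiff_one_iff_deriv, hderiv_eq]
    exact ⟨fun x => (hderiv x).differentiableAt, hc_cont⟩
  · have : ∀ y ∈ uIcc 0 x, c y = 0 := fun y hy => hc_zero y (by
      have := abs_sub_left_of_mem_uIcc hy
      simp only [sub_zero] at this
      exact this.trans hx)
    exact (intervalIntegral.integral_congr this).trans (by simp)
  · rw [hderiv_eq, abs_of_nonneg (hc0 x)]
    exact hc1 x
  · have hx : x = ∫ _ in (0 : ℝ)..x, (1 : ℝ) := by simp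
    nth_rewrite 2 [hx]
    rw [← intervalIntegral.integral_sub (hc_cont.intervalIntegrable _ _) (by simp)]
    have hind : Integrable (indicator (Icc (-(2 * ε)) (2 * ε)) (fun _ : ℝ => (1 : ℝ))) := by
      rw [integrable_indicator_iff measurableSet_Icc]
      exact continuousOn_const.integrableOn_Icc
    calc |∫ y in (0 : ℝ)..x, (c y - 1)|
        ≤ ∫ y in uIoc 0 x, |c y - 1| := by
          simpa using intervalIntegral.norm_integral_le_integral_norm_uIoc
            (f := fun y => c y - 1) (a := 0) (b := x) (μ := volume)
      _ ≤ ∫ y in uIoc 0 x, indicator (Icc (-(2 * ε)) (2 * ε)) (fun _ : ℝ => (1 : ℝ)) y := by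
          refine setIntegral_mono ?_ hind.integrableOn fun y => ?_
          · exact (((hc_cont.sub continuous_const).abs).intervalIntegrable 0 x).def'
          · by_cases hy : |y| ≤ 2 * ε
            · rw [indicator_of_mem (mem_Icc.2 (abs_le.1 hy))]
              exact abs_le.2 ⟨by linarith [hc0 y], by linarith [hc1 y]⟩
            · simp only [hc_one y (not_le.1 hy), sub_self, abs_zero]
              exact indicator_nonneg (fun _ _ => zero_le_one) _
      _ ≤ ∫ y, indicator (Icc (-(2 * ε)) (2 * ε)) (fun _ : ℝ => (1 : ℝ)) y :=
          setIntegral_le_integral hind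
            (ae_of_all _ fun y => indicator_nonneg (fun _ _ => zero_le_one) _)
      _ = 4 * ε := by
          rw [integral_indicator measurableSet_Icc]
          simp only [integral_const, smul_eq_mul, mul_one, measureReal_restrict_apply_univ,
            volume_real_Icc]
          rw [max_eq_left (by linarith)]
          ring

lemma dV2_eq_fderiv {v : ℝ × ℝ → ℝ} {t : ℝ × ℝ} (h : DifferentiableAt ℝ v t) :
    dV2 v t = fderiv ℝ v t (1, 0) := by
  have h1 : HasDerivAt (fun u : ℝ => (u, t.2)) (1, 0) t.1 :=
    (hasDerivAt_id t.1).prodMk (hasDerivAt_const _ _)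
  exact (h.hasFDerivAt.comp_hasDerivAt (x := t.1) (f := fun u => (u, t.2)) h1).deriv

lemma dV3_eq_fderiv {v : ℝ × ℝ → ℝ} {t : ℝ × ℝ} (h : DifferentiableAt ℝ v t) :
    dV3 v t = fderiv ℝ v t (0, 1) := by
  have h1 : HasDerivAt (fun u : ℝ => (t.1, u)) (0, 1) t.2 :=
    (hasDerivAt_const _ _).prodMk (hasDerivAt_id t.2)
  exact (h.hasFDerivAt.comp_hasDerivAt (x := t.2) (f := fun u => (t.1, u)) h1).deriv

/-- Convergence of `L²` integrals over a bounded set for mollifications of a continuous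
compactly supported function. -/
lemma tendsto_integral_sq_normed_convolution {ω : Set (ℝ × ℝ)}
    (hω_bdd : Bornology.IsBounded ω) {φ : ℕ → ContDiffBump (0 : ℝ × ℝ)}
    (hφ : Filter.Tendsto (fun n => (φ n).rOut) Filter.atTop (nhds 0))
    {g : ℝ × ℝ → ℝ} (hg : Continuous g) (hgc : HasCompactSupport g) :
    Filter.Tendsto (fun n => ∫ t in ω,
        (convolution ((φ n).normed volume) g (ContinuousLinearMap.lsmul ℝ ℝ) volume t) ^ 2)
      Filter.atTop (nhds (∫ t in ω, (g t) ^ 2)) := by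
  obtain ⟨M, hM⟩ := hgc.exists_bound_of_continuous hg
  have : IsFiniteMeasure (volume.restrict ω) :=
    isFiniteMeasure_restrict.2 hω_bdd.measure_lt_top.ne
  have hcont : ∀ n, Continuous
      (convolution ((φ n).normed volume) g (ContinuousLinearMap.lsmul ℝ ℝ) volume) := fun n =>
    ((φ n).hasCompactSupport_normed (μ := volume)).continuous_convolution_left _
      ((φ n).continuous_normed) hg.locallyIntegrable
  refine tendsto_integral_of_dominated_convergence (fun _ => (3 * M) ^ 2)
    (fun n => ((hcont n).pow 2).aestronglyMeasurable) (integrable_const _) (fun n => ?_) ?_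
  · refine ae_of_all _ fun t => ?_
    have h1 : dist (convolution ((φ n).normed volume) g (ContinuousLinearMap.lsmul ℝ ℝ)
        volume t) (g t) ≤ M + M :=
      ContDiffBump.dist_normed_convolution_le hg.aestronglyMeasurable
        fun x _ => (dist_le_norm_add_norm _ _).trans (add_le_add (hM x) (hM t))
    have h2 := hM t
    rw [Real.dist_eq] at h1
    rw [Real.norm_eq_abs] at h2 ⊢
    rw [abs_of_nonneg (sq_nonneg _), sq_le_sq]
    refine le_trans ?_ (le_abs_self _)
    rw [abs_le] at *
    constructor <;> linarith [h1.1, h1.2, h2.1, h2.2]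
  · exact ae_of_all _ fun t =>
      (ContDiffBump.convolution_tendsto_right_of_continuous hφ hg t).pow 2

lemma integral_gradVsq_eq (ω : Set (ℝ × ℝ)) {v : ℝ × ℝ → ℝ} (hv : ContDiff ℝ 1 v)
    (hvc : HasCompactSupport v) :
    ∫ t in ω, gradVsq v t = (∫ t in ω, (fderiv ℝ v t (1, 0)) ^ 2)
      + ∫ t in ω, (fderiv ℝ v t (0, 1)) ^ 2 := by
  have hint : ∀ e, IntegrableOn (fun t => (fderiv ℝ v t e) ^ 2) ω := fun e => by
    have hg : Continuous fun t => fderiv ℝ v t e :=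
      (hv.continuous_fderiv one_ne_zero).clm_apply continuous_const
    have hgc : HasCompactSupport fun t => (fderiv ℝ v t e) ^ 2 :=
      (hvc.fderiv_apply ℝ e).comp_left (g := fun x : ℝ => x ^ 2) (by simp)
    exact ((hg.pow 2).integrable_of_hasCompactSupport hgc).integrableOn
  rw [← integral_add (hint _) (hint _)]
  refine integral_congr_ae (ae_of_all _ fun t => ?_)
  have hd := hv.differentiable one_ne_zero t
  simp only [gradVsq, dV2_eq_fderiv hd, dV3_eq_fderiv hd]

open scoped Pointwise in
/-- The Poincaré inequality extends from `C_c^∞(ω)` to `C_c¹(ω)`. -/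
lemma poincare_of_contDiff_one {ω : Set (ℝ × ℝ)} (hω_open : IsOpen ω)
    (hω_bdd : Bornology.IsBounded ω) {E₁ : ℝ}
    (hPoincare : ∀ v : ℝ × ℝ → ℝ, TestFun ω v →
      (∫ t in ω, gradVsq v t) ≥ E₁ * ∫ t in ω, (v t) ^ 2)
    {w : ℝ × ℝ → ℝ} (hw : ContDiff ℝ 1 w) (hwc : HasCompactSupport w) (hwω : tsupport w ⊆ ω) :
    E₁ * ∫ t in ω, (w t) ^ 2 ≤ ∫ t in ω, gradVsq w t := by
  obtain ⟨δ, hδ, hδω⟩ := hwc.isCompact.exists_cthickening_subset_open hω_open hwω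
  set φ : ℕ → ContDiffBump (0 : ℝ × ℝ) := fun n =>
    ⟨δ / (n + 1) / 2, δ / (n + 1), by positivity, half_lt_self (by positivity)⟩ with hφdef
  have hφ : Filter.Tendsto (fun n => (φ n).rOut) Filter.atTop (nhds 0) := by
    have := (tendsto_one_div_add_atTop_nhds_zero_nat (𝕜 := ℝ)).const_mul δ
    simpa [hφdef, div_eq_mul_inv] using this
  set u : ℕ → ℝ × ℝ → ℝ := fun n =>
    convolution ((φ n).normed volume) w (ContinuousLinearMap.lsmul ℝ ℝ) volume with hu
  have hloc : ∀ n, LocallyIntegrable ((φ n).normed (volume : Measure (ℝ × ℝ))) volume := fun n =>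
    (φ n).continuous_normed.locallyIntegrable
  have hfd_cont : Continuous (fderiv ℝ w) := hw.continuous_fderiv one_ne_zero
  have hfderiv : ∀ n t e, DifferentiableAt ℝ (u n) t ∧ fderiv ℝ (u n) t e =
      convolution ((φ n).normed volume) (fun x => fderiv ℝ w x e)
        (ContinuousLinearMap.lsmul ℝ ℝ) volume t := fun n t e => by
    have := hwc.hasFDerivAt_convolution_right (ContinuousLinearMap.lsmul ℝ ℝ) (hloc n) hw t
    refine ⟨this.differentiableAt, ?_⟩
    rw [this.fderiv]
    exact convolution_precompR_apply _ (hloc n) (hwc.fderiv ℝ) hfd_cont t e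
  have htest : ∀ n, TestFun ω (u n) := fun n => by
    have hsub : tsupport (u n) ⊆ Metric.cthickening δ (tsupport w) := by
      refine closure_minimal ?_ Metric.isClosed_cthickening
      refine (support_convolution_subset _).trans ?_
      rw [(φ n).support_normed_eq, ← hwc.isCompact.add_closedBall_zero hδ.le, add_comm]
      refine Set.add_subset_add (subset_tsupport w) ?_
      refine Metric.ball_subset_closedBall.trans (Metric.closedBall_subset_closedBall ?_)
      exact div_le_self hδ.le (by linarith [(n.cast_nonneg : (0 : ℝ) ≤ n)])
    refine ⟨?_, ?_, hsub.trans hδω⟩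
    · exact (φ n).hasCompactSupport_normed.contDiff_convolution_left _ (φ n).contDiff_normed
        hw.continuous.locallyIntegrable
    · exact hwc.isCompact.cthickening.of_isClosed_subset (isClosed_tsupport _) hsub
  have hlim := fun e => tendsto_integral_sq_normed_convolution hω_bdd hφ
    (g := fun t => fderiv ℝ w t e) (hfd_cont.clm_apply continuous_const) (hwc.fderiv_apply ℝ e)
  rw [integral_gradVsq_eq ω hw hwc]
  refine le_of_tendsto_of_tendsto'
    ((tendsto_integral_sq_normed_convolution hω_bdd hφ hw.continuous hwc).const_mul E₁)
    ((hlim (1, 0)).add (hlim (0, 1))) fun n => ?_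
  have := hPoincare (u n) (htest n)
  rw [integral_gradVsq_eq ω ((htest n).1.of_le (by exact_mod_cast le_top)) (htest n).2.1] at this
  simpa only [(hfderiv n _ _).2] using this

/-- The Poincaré inequality for a `C¹` function that vanishes continuously on the boundary. -/
lemma poincare_of_eq_zero_on_frontier {ω : Set (ℝ × ℝ)} (hω_open : IsOpen ω)
    (hω_bdd : Bornology.IsBounded ω) {E₁ : ℝ}
    (hPoincare : ∀ v : ℝ × ℝ → ℝ, TestFun ω v →
      (∫ t in ω, gradVsq v t) ≥ E₁ * ∫ t in ω, (v t) ^ 2)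
    {v : ℝ × ℝ → ℝ} (hv : ContDiffOn ℝ 1 v ω) (hvc : ContinuousOn v (closure ω))
    (hv0 : ∀ t ∈ frontier ω, v t = 0) (hvi : IntegrableOn (gradVsq v) ω) :
    E₁ * ∫ t in ω, (v t) ^ 2 ≤ ∫ t in ω, gradVsq v t := by
  have hfin : IsFiniteMeasure (volume.restrict ω) :=
    isFiniteMeasure_restrict.2 hω_bdd.measure_lt_top.ne
  have hcpt : IsCompact (closure ω) := hω_bdd.isCompact_closure
  obtain ⟨M, hM⟩ := hcpt.exists_bound_of_continuousOn hvc
  choose T hT1 hT0 hT' hTx using fun n : ℕ =>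
    exists_contDiff_truncation (ε := 1 / ((n : ℝ) + 1)) (by positivity)
  have hTtends : ∀ x, Filter.Tendsto (fun n => T n x) Filter.atTop (nhds x) := fun x => by
    rw [tendsto_iff_dist_tendsto_zero]
    refine squeeze_zero (fun _ => dist_nonneg) (fun n => hTx n x) ?_
    simpa using (tendsto_one_div_add_atTop_nhds_zero_nat (𝕜 := ℝ)).const_mul 4
  have hmain : ∀ n, E₁ * ∫ t in ω, (T n (v t)) ^ 2 ≤ ∫ t in ω, gradVsq v t := fun n => by
    set ε : ℝ := 1 / ((n : ℝ) + 1) with hε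
    have hεpos : 0 < ε := by positivity
    set Kε : Set (ℝ × ℝ) := closure ω ∩ (fun t => |v t|) ⁻¹' Ici ε with hKε
    have hKclosed : IsClosed Kε := hvc.abs.preimage_isClosed_of_isClosed isClosed_closure isClosed_Ici
    have hKω : Kε ⊆ ω := fun t ht => by
      by_contra hnot
      have : t ∈ frontier ω := by
        rw [hω_open.frontier_eq]
        exact ⟨ht.1, hnot⟩
      have h2 : ε ≤ |v t| := ht.2
      rw [hv0 t this, abs_zero] at h2
      linarith
    set w : ℝ × ℝ → ℝ := ω.indicator (fun t => T n (v t)) with hw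
    have hwzero : ∀ t ∉ Kε, w t = 0 := fun t ht => by
      by_cases htω : t ∈ ω
      · rw [hw, indicator_of_mem htω]
        refine hT0 n _ (le_of_not_ge fun h => ht ⟨subset_closure htω, h⟩)
      · exact indicator_of_notMem htω _
    have hsupp : tsupport w ⊆ Kε :=
      closure_minimal (fun t ht => by_contra fun h => ht (hwzero t h)) hKclosed
    have hwev : ∀ t ∈ ω, w =ᶠ[nhds t] fun t => T n (v t) := fun t ht => by
      filter_upwards [hω_open.mem_nhds ht] with x hx using indicator_of_mem hx _
    have hvat : ∀ t ∈ ω, ContDiffAt ℝ 1 v t := fun t ht => hv.contDiffAt (hω_open.mem_nhds ht)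
    have hwC1 : ContDiff ℝ 1 w := contDiff_iff_contDiffAt.2 fun t => by
      by_cases ht : t ∈ ω
      · exact (((hT1 n).contDiffAt).comp t (hvat t ht)).congr_of_eventuallyEq (hwev t ht)
      · have : w =ᶠ[nhds t] fun _ => 0 := by
          filter_upwards [hKclosed.isOpen_compl.mem_nhds fun h => ht (hKω h)] with x hx
            using hwzero x hx
        exact contDiffAt_const.congr_of_eventuallyEq this
    have hwcs : HasCompactSupport w :=
      hcpt.of_isClosed_subset (isClosed_tsupport _) (hsupp.trans inter_subset_left)
    have key := poincare_of_contDiff_one hω_open hω_bdd hPoincare hwC1 hwcs (hsupp.trans hKω)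
    have hsq : ∫ t in ω, (w t) ^ 2 = ∫ t in ω, (T n (v t)) ^ 2 :=
      setIntegral_congr_fun hω_open.measurableSet fun t ht => by
        simp only [hw, indicator_of_mem ht]
    rw [hsq] at key
    refine key.trans (integral_mono_of_nonneg (ae_of_all _ fun t => ?_) hvi ?_)
    · exact add_nonneg (sq_nonneg _) (sq_nonneg _)
    · filter_upwards [ae_restrict_mem hω_open.measurableSet] with t ht
      have hd : DifferentiableAt ℝ v t := (hvat t ht).differentiableAt one_ne_zero
      have hfd : fderiv ℝ w t = deriv (T n) (v t) • fderiv ℝ v t := by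
        rw [(hwev t ht).fderiv_eq]
        exact ((((hT1 n).differentiable one_ne_zero) (v t)).hasDerivAt.comp_hasFDerivAt t
          hd.hasFDerivAt).fderiv
      have hdw : DifferentiableAt ℝ w t := hwC1.differentiable one_ne_zero t
      simp only [gradVsq]
      rw [dV2_eq_fderiv hdw, dV3_eq_fderiv hdw, dV2_eq_fderiv hd, dV3_eq_fderiv hd, hfd]
      simp only [_root_.smul_apply, smul_eq_mul, mul_pow]
      have h1 : deriv (T n) (v t) ^ 2 ≤ 1 := (sq_le_one_iff_abs_le_one _).2 (hT' n _)
      exact add_le_add (mul_le_of_le_one_left (sq_nonneg _) h1)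
        (mul_le_of_le_one_left (sq_nonneg _) h1)
  have hlim : Filter.Tendsto (fun n => ∫ t in ω, (T n (v t)) ^ 2) Filter.atTop
      (nhds (∫ t in ω, (v t) ^ 2)) := by
    refine tendsto_integral_of_dominated_convergence (fun _ => (M + 4) ^ 2) (fun n => ?_)
      (integrable_const _) (fun n => ?_) (ae_of_all _ fun t => (hTtends (v t)).pow 2)
    · exact ((((hT1 n).continuous.comp_continuousOn hv.continuousOn)).pow 2).aestronglyMeasurable
        hω_open.measurableSet
    · filter_upwards [ae_restrict_mem hω_open.measurableSet] with t ht
      have h1 := hM t (subset_closure ht)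
      have h2 := hTx n (v t)
      have h3 : (1 : ℝ) / ((n : ℝ) + 1) ≤ 1 :=
        div_le_self zero_le_one (by linarith [(n.cast_nonneg : (0 : ℝ) ≤ n)])
      rw [Real.norm_eq_abs] at h1 ⊢
      rw [abs_of_nonneg (sq_nonneg _), sq_le_sq]
      refine le_trans ?_ (le_abs_self _)
      rw [abs_le] at *
      constructor <;> linarith [h1.1, h1.2, h2.1, h2.2]
  exact le_of_tendsto' (hlim.const_mul E₁) hmain

lemma sq_intervalIntegral_le {f : ℝ → ℝ} (hf : Continuous f) {r s : ℝ} (hrs : r ≤ s) :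
    (∫ y in r..s, f y) ^ 2 ≤ (s - r) * ∫ y in r..s, (f y) ^ 2 := by
  rcases hrs.eq_or_lt with rfl | hlt
  · simp
  set I := ∫ y in r..s, f y with hI
  set c := I / (s - r) with hc
  have hpos : 0 < s - r := sub_pos.2 hlt
  have h0 : 0 ≤ ∫ y in r..s, (f y - c) ^ 2 :=
    intervalIntegral.integral_nonneg hrs fun y _ => sq_nonneg _
  have h1 : ∫ y in r..s, (f y - c) ^ 2 = (∫ y in r..s, (f y) ^ 2) - 2 * c * I
      + (s - r) * c ^ 2 := by
    have : ∀ y, (f y - c) ^ 2 = ((f y) ^ 2 - 2 * c * f y) + c ^ 2 := fun y => by ring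
    simp only [this]
    rw [intervalIntegral.integral_add, intervalIntegral.integral_sub,
      intervalIntegral.integral_const_mul, intervalIntegral.integral_const, smul_eq_mul]
    all_goals exact Continuous.intervalIntegrable (by fun_prop) _ _
  have h2 : (s - r) * c = I := by rw [hc]; field_simp
  have h3 : (s - r) * ((∫ y in r..s, (f y) ^ 2) - 2 * c * I + (s - r) * c ^ 2)
      = (s - r) * (∫ y in r..s, (f y) ^ 2) - I ^ 2 := by
    linear_combination (-2 * I + (s - r) * c + I) * h2
  have h4 := mul_nonneg hpos.le (h1 ▸ h0)
  linarith

lemma rho_nonneg (p s : ℝ) : 0 ≤ rho p s := by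
  unfold rho
  split_ifs <;> positivity

lemma rho_le_one (p s : ℝ) : rho p s ≤ 1 := by
  unfold rho
  split_ifs
  · exact div_le_self zero_le_one (by nlinarith [sq_nonneg (s - p)])
  · exact zero_le_one

lemma measurable_rho (p : ℝ) : Measurable (rho p) :=
  Measurable.ite measurableSet_Iic (by fun_prop) measurable_const

lemma integral_rho_unit (p : ℝ) : ∫ r in Ioc (p - 1) p, rho p r = π / 4 := by
  have h1 : ∫ r in Ioc (p - 1) p, rho p r = ∫ r in Ioc (p - 1) p, (1 + (r - p) ^ 2)⁻¹ :=
    setIntegral_congr_fun measurableSet_Ioc fun r hr => by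
      simp only [rho, if_pos hr.2, one_div]
  rw [h1, ← intervalIntegral.integral_of_le (by linarith),
    intervalIntegral.integral_comp_sub_right (fun x => (1 + x ^ 2)⁻¹) p, integral_inv_one_add_sq]
  simp [Real.arctan_neg]

/-- Values of `f` to the right of `p` are controlled by the Hardy weight and the derivative. -/
lemma sq_le_hardyWeight_add_deriv {f : ℝ → ℝ} (hf : ContDiff ℝ 1 f)
    (hf2 : Integrable fun s => (f s) ^ 2) (hf'2 : Integrable fun s => (deriv f s) ^ 2)
    {p s : ℝ} (hps : p ≤ s) :
    (f s) ^ 2 ≤ 8 / π * (∫ r, rho p r * (f r) ^ 2)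
      + 2 * (s - p + 1) * ∫ r, (deriv f r) ^ 2 := by
  have hcd : Continuous (deriv f) := hf.continuous_deriv le_rfl
  set D := ∫ r, (deriv f r) ^ 2 with hD
  have hD0 : 0 ≤ D := integral_nonneg fun _ => sq_nonneg _
  have hρint : Integrable fun r => rho p r * (f r) ^ 2 :=
    hf2.bdd_mul (c := 1) (measurable_rho p).aestronglyMeasurable (ae_of_all _ fun r => by
      rw [Real.norm_eq_abs, abs_of_nonneg (rho_nonneg p r)]
      exact rho_le_one p r)
  have hptw : ∀ r ∈ Ioc (p - 1) p, (f s) ^ 2 ≤ 2 * (f r) ^ 2 + 2 * (s - p + 1) * D := by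
    intro r hr
    have hrs : r ≤ s := hr.2.trans hps
    have hftc : ∫ y in r..s, deriv f y = f s - f r :=
      intervalIntegral.integral_deriv_eq_sub
        (fun y _ => hf.differentiable one_ne_zero y) (hcd.intervalIntegrable _ _)
    have hcs := sq_intervalIntegral_le hcd hrs
    have hle : ∫ y in r..s, (deriv f y) ^ 2 ≤ D := by
      rw [intervalIntegral.integral_of_le hrs]
      exact setIntegral_le_integral hf'2 (ae_of_all _ fun _ => sq_nonneg _)
    have h1 : (s - r) * ∫ y in r..s, (deriv f y) ^ 2 ≤ (s - p + 1) * D := by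
      refine mul_le_mul (by linarith [hr.1]) hle ?_ (by linarith)
      exact intervalIntegral.integral_nonneg hrs fun _ _ => sq_nonneg _
    rw [hftc] at hcs
    nlinarith [sq_nonneg (f s - 2 * f r)]
  have hρ1 : IntegrableOn (rho p) (Ioc (p - 1) p) :=
    Measure.integrableOn_of_bounded (M := 1) (by simp)
      (measurable_rho p).aestronglyMeasurable (ae_of_all _ fun r => by
        rw [Real.norm_eq_abs, abs_of_nonneg (rho_nonneg p r)]
        exact rho_le_one p r)
  have hint : ∫ r in Ioc (p - 1) p, rho p r * (f s) ^ 2 ≤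
      ∫ r in Ioc (p - 1) p, (2 * (rho p r * (f r) ^ 2) + rho p r * (2 * (s - p + 1) * D)) :=
    setIntegral_mono_on (hρ1.mul_const _)
      ((hρint.integrableOn.const_mul 2).add (hρ1.mul_const _)) measurableSet_Ioc fun r hr => by
        have := mul_le_mul_of_nonneg_left (hptw r hr) (rho_nonneg p r)
        linarith
  rw [integral_mul_const, integral_add (hρint.integrableOn.const_mul 2) (hρ1.mul_const _),
    integral_const_mul, integral_mul_const, integral_rho_unit] at hint
  have hle : ∫ r in Ioc (p - 1) p, rho p r * (f r) ^ 2 ≤ ∫ r, rho p r * (f r) ^ 2 :=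
    setIntegral_le_integral hρint
      (ae_of_all _ fun r => mul_nonneg (rho_nonneg p r) (sq_nonneg _))
  have hπ := Real.pi_pos
  have h8 : 8 / π * (∫ r, rho p r * (f r) ^ 2) = (4 / π) * (2 * ∫ r, rho p r * (f r) ^ 2) := by
    ring
  have h4 : (4 / π) * (π / 4) = 1 := by field_simp
  have h5 : (4 / π) * (π / 4 * (f s) ^ 2) ≤
      (4 / π) * (2 * (∫ r, rho p r * (f r) ^ 2) + π / 4 * (2 * (s - p + 1) * D)) :=
    mul_le_mul_of_nonneg_left (by linarith) (by positivity)
  rw [mul_add, ← mul_assoc, ← mul_assoc (4 / π) (π / 4), h4] at h5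
  rw [h8]
  linarith

/-- One-dimensional control of the `L²` mass in a window `(a, a + l)` to the right of `p`. -/
lemma setIntegral_window_sq_le {f : ℝ → ℝ} (hf : ContDiff ℝ 1 f)
    (hf2 : Integrable fun s => (f s) ^ 2) (hf'2 : Integrable fun s => (deriv f s) ^ 2)
    {p a l : ℝ} (hpa : p ≤ a) (hl : 0 < l) :
    ∫ s in Ioo a (a + l), (f s) ^ 2 ≤ 8 * l / π * (∫ r, rho p r * (f r) ^ 2)
      + 2 * l * (a + l - p + 1) * ∫ r, (deriv f r) ^ 2 := by
  have hD0 : 0 ≤ ∫ r, (deriv f r) ^ 2 := integral_nonneg fun _ => sq_nonneg _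
  have h := setIntegral_mono_on hf2.integrableOn
    (integrableOn_const (C := 8 / π * (∫ r, rho p r * (f r) ^ 2)
      + 2 * (a + l - p + 1) * ∫ r, (deriv f r) ^ 2) (s := Ioo a (a + l)) (by simp) (by simp))
    measurableSet_Ioo fun s hs => by
      refine (sq_le_hardyWeight_add_deriv hf hf2 hf'2 (hpa.trans hs.1.le)).trans ?_
      have := hs.2
      gcongr
  refine h.trans (le_of_eq ?_)
  simp only [integral_const, smul_eq_mul, measureReal_restrict_apply_univ, volume_real_Ioo]
  rw [max_eq_left (by linarith)]
  ring

lemma dS_eq_fderiv_s15 {ψ : ℝ × ℝ × ℝ → ℝ} {x : ℝ × ℝ × ℝ} (h : DifferentiableAt ℝ ψ x) :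
    dS ψ x = fderiv ℝ ψ x (1, 0) := by
  have h1 : HasDerivAt (fun u : ℝ => (u, x.2)) (1, 0) x.1 :=
    (hasDerivAt_id x.1).prodMk (hasDerivAt_const _ _)
  exact (h.hasFDerivAt.comp_hasDerivAt (x := x.1) (f := fun u => (u, x.2)) h1).deriv

lemma dT2_eq_fderiv_s15 {ψ : ℝ × ℝ × ℝ → ℝ} {x : ℝ × ℝ × ℝ} (h : DifferentiableAt ℝ ψ x) :
    dT2 ψ x = fderiv ℝ ψ x (0, 1, 0) := by
  have h1 : HasDerivAt (fun u : ℝ => (x.1, u, x.2.2)) (0, 1, 0) x.2.1 :=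
    (hasDerivAt_const _ _).prodMk ((hasDerivAt_id x.2.1).prodMk (hasDerivAt_const _ _))
  exact (h.hasFDerivAt.comp_hasDerivAt (x := x.2.1) (f := fun u => (x.1, u, x.2.2)) h1).deriv

lemma dT3_eq_fderiv_s15 {ψ : ℝ × ℝ × ℝ → ℝ} {x : ℝ × ℝ × ℝ} (h : DifferentiableAt ℝ ψ x) :
    dT3 ψ x = fderiv ℝ ψ x (0, 0, 1) := by
  have h1 : HasDerivAt (fun u : ℝ => (x.1, x.2.1, u)) (0, 0, 1) x.2.2 :=
    (hasDerivAt_const _ _).prodMk ((hasDerivAt_const _ _).prodMk (hasDerivAt_id x.2.2))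
  exact (h.hasFDerivAt.comp_hasDerivAt (x := x.2.2) (f := fun u => (x.1, x.2.1, u)) h1).deriv

lemma volume_restrict_prod (S : Set ℝ) (ω : Set (ℝ × ℝ)) :
    (volume : Measure (ℝ × ℝ × ℝ)).restrict (S ×ˢ ω)
      = (volume.restrict S).prod (volume.restrict ω) := by
  rw [Measure.prod_restrict, ← Measure.volume_eq_prod]

namespace Admissible

variable {ω : Set (ℝ × ℝ)} {a l : ℝ} {ψ : ℝ × ℝ × ℝ → ℝ}

lemma contDiffAt (h : Admissible ω a l ψ) (hω : IsOpen ω) {x : ℝ × ℝ × ℝ} (hx : x.2 ∈ ω) :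
    ContDiffAt ℝ 1 ψ x := by
  refine h.1.contDiffAt (Filter.mem_of_superset ((isOpen_univ.prod hω).mem_nhds ⟨mem_univ _, hx⟩) ?_)
  exact prod_mono_right subset_closure

lemma continuousOn_fderiv_apply (h : Admissible ω a l ψ) (hω : IsOpen ω) (e : ℝ × ℝ × ℝ) :
    ContinuousOn (fun x => fderiv ℝ ψ x e) ((univ : Set ℝ) ×ˢ ω) :=
  ((h.1.mono (prod_mono_right subset_closure)).continuousOn_fderiv_of_isOpen
    (isOpen_univ.prod hω) le_rfl).clm_apply continuousOn_const

lemma continuousOn_dS (h : Admissible ω a l ψ) (hω : IsOpen ω) :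
    ContinuousOn (dS ψ) ((univ : Set ℝ) ×ˢ ω) :=
  (h.continuousOn_fderiv_apply hω (1, 0)).congr fun _ hx =>
    dS_eq_fderiv_s15 ((h.contDiffAt hω hx.2).differentiableAt one_ne_zero)

lemma continuousOn_dT2 (h : Admissible ω a l ψ) (hω : IsOpen ω) :
    ContinuousOn (dT2 ψ) ((univ : Set ℝ) ×ˢ ω) :=
  (h.continuousOn_fderiv_apply hω (0, 1, 0)).congr fun _ hx =>
    dT2_eq_fderiv_s15 ((h.contDiffAt hω hx.2).differentiableAt one_ne_zero)

lemma continuousOn_dT3 (h : Admissible ω a l ψ) (hω : IsOpen ω) :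
    ContinuousOn (dT3 ψ) ((univ : Set ℝ) ×ˢ ω) :=
  (h.continuousOn_fderiv_apply hω (0, 0, 1)).congr fun _ hx =>
    dT3_eq_fderiv_s15 ((h.contDiffAt hω hx.2).differentiableAt one_ne_zero)

lemma integrableOn_sq (h : Admissible ω a l ψ) :
    IntegrableOn (fun x => (ψ x) ^ 2) ((univ : Set ℝ) ×ˢ ω) := h.2.1

lemma integrableOn_dS_sq (h : Admissible ω a l ψ) :
    IntegrableOn (fun x => (dS ψ x) ^ 2) ((univ : Set ℝ) ×ˢ ω) := h.2.2.1

lemma integrableOn_gradTsq (h : Admissible ω a l ψ) :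
    IntegrableOn (gradTsq ψ) ((univ : Set ℝ) ×ˢ ω) := h.2.2.2.1.add h.2.2.2.2.1

lemma integrableOn_rho_mul_sq (h : Admissible ω a l ψ) (p : ℝ) :
    IntegrableOn (fun x => rho p x.1 * (ψ x) ^ 2) ((univ : Set ℝ) ×ˢ ω) :=
  h.integrableOn_sq.bdd_mul (c := 1)
    ((measurable_rho p).comp measurable_fst).aestronglyMeasurable (ae_of_all _ fun x => by
      rw [Real.norm_eq_abs, abs_of_nonneg (rho_nonneg p x.1)]
      exact rho_le_one p x.1)

lemma integrableOn_gpot_mul_sq (h : Admissible ω a l ψ) (E₁ : ℝ) :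
    IntegrableOn (fun x => gpot E₁ a l x.1 * (ψ x) ^ 2) ((univ : Set ℝ) ×ˢ ω) := by
  have hm : Measurable (gpot E₁ a l) :=
    Measurable.ite measurableSet_Ioo measurable_const measurable_const
  refine h.integrableOn_sq.bdd_mul (c := |E₁|)
    (hm.comp measurable_fst).aestronglyMeasurable (ae_of_all _ fun x => ?_)
  unfold gpot
  split_ifs <;> simp

lemma integrableOn_twist_sq (h : Admissible ω a l ψ) (hω : IsOpen ω)
    (hω_bdd : Bornology.IsBounded ω) {η : ℝ → ℝ} (hη : Continuous η)
    (hηc : HasCompactSupport η) :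
    IntegrableOn (fun x => (η x.1 * dTau ψ x) ^ 2) ((univ : Set ℝ) ×ˢ ω) := by
  obtain ⟨M, hM⟩ := hηc.exists_bound_of_continuous hη
  obtain ⟨R, hR⟩ := hω_bdd.exists_norm_le
  have hΩ : MeasurableSet ((univ : Set ℝ) ×ˢ ω) := (isOpen_univ.prod hω).measurableSet
  have hc : ContinuousOn (fun x => (η x.1 * dTau ψ x) ^ 2) ((univ : Set ℝ) ×ˢ ω) := by
    have h2 := h.continuousOn_dT2 hω
    have h3 := h.continuousOn_dT3 hω
    unfold dTau
    fun_prop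
  refine (h.integrableOn_gradTsq.const_mul (2 * (M ^ 2 * R ^ 2))).mono'
    (hc.aestronglyMeasurable hΩ) ?_
  filter_upwards [ae_restrict_mem hΩ] with x hx
  have h0 : (η x.1) ^ 2 ≤ M ^ 2 := sq_le_sq' (abs_le.1 (hM x.1)).1 (abs_le.1 (hM x.1)).2
  have hx2 := hR _ hx.2
  have h1 : |x.2.1| ≤ R := (norm_fst_le x.2).trans hx2
  have h2 : |x.2.2| ≤ R := (norm_snd_le x.2).trans hx2
  have h1' : x.2.1 ^ 2 ≤ R ^ 2 := sq_le_sq' (abs_le.1 h1).1 (abs_le.1 h1).2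
  have h2' : x.2.2 ^ 2 ≤ R ^ 2 := sq_le_sq' (abs_le.1 h2).1 (abs_le.1 h2).2
  rw [Real.norm_eq_abs, abs_of_nonneg (sq_nonneg _), mul_pow]
  have h3 : (dTau ψ x) ^ 2 ≤ 2 * R ^ 2 * gradTsq ψ x := by
    unfold dTau gradTsq
    nlinarith [sq_nonneg (x.2.1 * dT3 ψ x + x.2.2 * dT2 ψ x),
      mul_le_mul_of_nonneg_right h1' (sq_nonneg (dT3 ψ x)),
      mul_le_mul_of_nonneg_right h2' (sq_nonneg (dT2 ψ x)),
      mul_nonneg (sq_nonneg R) (sq_nonneg (dT3 ψ x)),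
      mul_nonneg (sq_nonneg R) (sq_nonneg (dT2 ψ x))]
  calc (η x.1) ^ 2 * (dTau ψ x) ^ 2 ≤ M ^ 2 * (2 * R ^ 2 * gradTsq ψ x) := by gcongr
    _ = 2 * (M ^ 2 * R ^ 2) * gradTsq ψ x := by ring

lemma integrableOn_dS_mul_twist (h : Admissible ω a l ψ) (hω : IsOpen ω)
    (hω_bdd : Bornology.IsBounded ω) {η : ℝ → ℝ} (hη : Continuous η)
    (hηc : HasCompactSupport η) :
    IntegrableOn (fun x => dS ψ x * (η x.1 * dTau ψ x)) ((univ : Set ℝ) ×ˢ ω) := by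
  have hΩ : MeasurableSet ((univ : Set ℝ) ×ˢ ω) := (isOpen_univ.prod hω).measurableSet
  have hc : ContinuousOn (fun x => dS ψ x * (η x.1 * dTau ψ x)) ((univ : Set ℝ) ×ˢ ω) := by
    have h1 := h.continuousOn_dS hω
    have h2 := h.continuousOn_dT2 hω
    have h3 := h.continuousOn_dT3 hω
    unfold dTau
    fun_prop
  refine (h.integrableOn_dS_sq.add (h.integrableOn_twist_sq hω hω_bdd hη hηc)).mono'
    (hc.aestronglyMeasurable hΩ) (ae_of_all _ fun x => ?_)
  simp only [Pi.add_apply, Real.norm_eq_abs]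
  refine abs_le.2 ⟨?_, ?_⟩ <;>
    nlinarith [sq_nonneg (dS ψ x + η x.1 * dTau ψ x), sq_nonneg (dS ψ x - η x.1 * dTau ψ x),
      sq_nonneg (dS ψ x), sq_nonneg (η x.1 * dTau ψ x)]

/-- Slicewise Poincaré inequality, integrated over any set of longitudinal positions. -/
lemma setIntegral_gradTsq_sub_gpot_nonneg (h : Admissible ω a l ψ) (hω : IsOpen ω)
    (hω_bdd : Bornology.IsBounded ω) {E₁ : ℝ}
    (hPoincare : ∀ v : ℝ × ℝ → ℝ, TestFun ω v →
      (∫ t in ω, gradVsq v t) ≥ E₁ * ∫ t in ω, (v t) ^ 2) (S : Set ℝ) :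
    0 ≤ ∫ x in S ×ˢ ω, (gradTsq ψ x - gpot E₁ a l x.1 * (ψ x) ^ 2) := by
  have hsub : S ×ˢ ω ⊆ (univ : Set ℝ) ×ˢ ω := prod_mono_left (subset_univ S)
  have hG := h.integrableOn_gradTsq.mono_set hsub
  have hψ := h.integrableOn_sq.mono_set hsub
  have hI : IntegrableOn (fun x => gradTsq ψ x - gpot E₁ a l x.1 * (ψ x) ^ 2) (S ×ˢ ω) :=
    hG.sub ((h.integrableOn_gpot_mul_sq E₁).mono_set hsub)
  rw [IntegrableOn, volume_restrict_prod] at hG hψ hI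
  rw [volume_restrict_prod]
  refine le_of_le_of_eq ?_ (integral_prod _ hI).symm
  refine integral_nonneg_of_ae ?_
  filter_upwards [hG.prod_right_ae, hψ.prod_right_ae] with s hGs hψs
  simp only [Pi.zero_apply]
  rw [integral_sub hGs (hψs.const_mul _), integral_const_mul, sub_nonneg]
  by_cases hs : s ∈ Ioo a (a + l)
  · rw [gpot, if_pos hs, zero_mul]
    exact integral_nonneg fun t => add_nonneg (sq_nonneg _) (sq_nonneg _)
  · rw [gpot, if_neg hs]
    have hmaps : MapsTo (fun t : ℝ × ℝ => (s, t)) (closure ω) ((univ : Set ℝ) ×ˢ closure ω) :=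
      fun t ht => ⟨mem_univ _, ht⟩
    have hv : ContDiffOn ℝ 1 (fun t => ψ (s, t)) (closure ω) :=
      h.1.comp (contDiff_const.prodMk contDiff_id).contDiffOn hmaps
    exact poincare_of_eq_zero_on_frontier hω hω_bdd hPoincare (hv.mono subset_closure)
      hv.continuousOn (fun t ht => h.2.2.2.2.2 s t ht hs) hGs

/-- The `L²` mass in the window is controlled by the Hardy weight and `∂_s ψ`. -/
lemma setIntegral_window_le (h : Admissible ω a l ψ) (hω : IsOpen ω) {p : ℝ} (hpa : p ≤ a)
    (hl : 0 < l) :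
    ∫ x in Ioo a (a + l) ×ˢ ω, (ψ x) ^ 2 ≤
      8 * l / π * (∫ x in (univ : Set ℝ) ×ˢ ω, rho p x.1 * (ψ x) ^ 2)
        + 2 * l * (a + l - p + 1) * ∫ x in (univ : Set ℝ) ×ˢ ω, (dS ψ x) ^ 2 := by
  have hW := h.integrableOn_sq.mono_set (prod_mono_left (subset_univ (Ioo a (a + l))))
  have hψ := h.integrableOn_sq
  have hρ := h.integrableOn_rho_mul_sq p
  have hD := h.integrableOn_dS_sq
  rw [IntegrableOn, volume_restrict_prod] at hW hψ hρ hD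
  rw [volume_restrict_prod, volume_restrict_prod, integral_prod_symm _ hW,
    integral_prod_symm _ hρ, integral_prod_symm _ hD, ← integral_const_mul, ← integral_const_mul,
    ← integral_add (hρ.integral_prod_right.const_mul _) (hD.integral_prod_right.const_mul _)]
  refine integral_mono_ae hW.integral_prod_right
    ((hρ.integral_prod_right.const_mul _).add (hD.integral_prod_right.const_mul _)) ?_
  filter_upwards [hψ.prod_left_ae, hD.prod_left_ae, ae_restrict_mem hω.measurableSet]
    with t hψt hDt ht
  simp only [Measure.restrict_univ] at hψt hDt ⊢
  have hf : ContDiff ℝ 1 fun s => ψ (s, t) := contDiff_iff_contDiffAt.2 fun s =>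
    (h.contDiffAt hω (x := (s, t)) ht).comp s (contDiffAt_id.prodMk contDiffAt_const)
  exact setIntegral_window_sq_le hf hψt hDt hpa hl

/-- Under the mixed-term bound, the form with potential `g` dominates half of `‖∂_s ψ‖²`. -/
lemma half_integral_dS_sq_le (h : Admissible ω a l ψ) (hω : IsOpen ω)
    (hω_bdd : Bornology.IsBounded ω) {E₁ : ℝ}
    (hPoincare : ∀ v : ℝ × ℝ → ℝ, TestFun ω v →
      (∫ t in ω, gradVsq v t) ≥ E₁ * ∫ t in ω, (v t) ^ 2)
    {η : ℝ → ℝ} (hη : Continuous η) (hηc : HasCompactSupport η) {m M : ℝ}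
    (hηsupp : ∀ s ∉ Ioo m M, η s = 0) (hMa : M ≤ a) {γ : ℝ} (hγ : γ ≤ 1)
    (hMixed : |2 * ∫ x in Ioo m M ×ˢ ω, dS ψ x * (η x.1 * dTau ψ x)|
        ≤ γ * ((∫ x in Ioo m M ×ˢ ω, gradTsq ψ x) - E₁ * ∫ x in Ioo m M ×ˢ ω, (ψ x) ^ 2)
          + (1 / 2) * (∫ x in Ioo m M ×ˢ ω, (dS ψ x) ^ 2)
          + (1 / 2) * ∫ x in Ioo m M ×ˢ ω, (η x.1 * dTau ψ x) ^ 2) :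
    (1 / 2) * (∫ x in (univ : Set ℝ) ×ˢ ω, (dS ψ x) ^ 2) ≤
      (∫ x in (univ : Set ℝ) ×ˢ ω, gradTsq ψ x)
        + (∫ x in (univ : Set ℝ) ×ˢ ω, (dS ψ x + η x.1 * dTau ψ x) ^ 2)
        - (∫ x in (univ : Set ℝ) ×ˢ ω, gpot E₁ a l x.1 * (ψ x) ^ 2) := by
  have hsub : Ioo m M ×ˢ ω ⊆ (univ : Set ℝ) ×ˢ ω := prod_mono_left (subset_univ _)
  have hΩ : MeasurableSet ((univ : Set ℝ) ×ˢ ω) := (isOpen_univ.prod hω).measurableSet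
  have hJ : MeasurableSet (Ioo m M ×ˢ ω) := (isOpen_Ioo.prod hω).measurableSet
  have hG := h.integrableOn_gradTsq
  have hgp := h.integrableOn_gpot_mul_sq E₁
  have hD := h.integrableOn_dS_sq
  have hT := h.integrableOn_twist_sq hω hω_bdd hη hηc
  have hX := h.integrableOn_dS_mul_twist hω hω_bdd hη hηc
  have hexpand : ∫ x in (univ : Set ℝ) ×ˢ ω, (dS ψ x + η x.1 * dTau ψ x) ^ 2 =
      (∫ x in (univ : Set ℝ) ×ˢ ω, (dS ψ x) ^ 2)
        + 2 * (∫ x in (univ : Set ℝ) ×ˢ ω, dS ψ x * (η x.1 * dTau ψ x))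
        + ∫ x in (univ : Set ℝ) ×ˢ ω, (η x.1 * dTau ψ x) ^ 2 := by
    have hDX : IntegrableOn (fun x => (dS ψ x) ^ 2 + 2 * (dS ψ x * (η x.1 * dTau ψ x)))
        ((univ : Set ℝ) ×ˢ ω) := hD.add (hX.const_mul 2)
    rw [← integral_const_mul, ← integral_add hD (hX.const_mul 2), ← integral_add hDX hT]
    congr 1 with x
    ring
  have hcross : ∫ x in (univ : Set ℝ) ×ˢ ω, dS ψ x * (η x.1 * dTau ψ x) =
      ∫ x in Ioo m M ×ˢ ω, dS ψ x * (η x.1 * dTau ψ x) :=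
    setIntegral_eq_of_subset_of_forall_sdiff_eq_zero hΩ hsub fun x hx => by
      rw [hηsupp x.1 fun hx1 => hx.2 ⟨hx1, hx.1.2⟩, zero_mul, mul_zero]
  have hDle : ∫ x in Ioo m M ×ˢ ω, (dS ψ x) ^ 2 ≤ ∫ x in (univ : Set ℝ) ×ˢ ω, (dS ψ x) ^ 2 :=
    setIntegral_mono_set hD (ae_of_all _ fun _ => sq_nonneg _) hsub.eventuallyLE
  have hTle : ∫ x in Ioo m M ×ˢ ω, (η x.1 * dTau ψ x) ^ 2 ≤
      ∫ x in (univ : Set ℝ) ×ˢ ω, (η x.1 * dTau ψ x) ^ 2 :=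
    setIntegral_mono_set hT (ae_of_all _ fun _ => sq_nonneg _) hsub.eventuallyLE
  have hT0 : 0 ≤ ∫ x in (univ : Set ℝ) ×ˢ ω, (η x.1 * dTau ψ x) ^ 2 :=
    integral_nonneg fun _ => sq_nonneg _
  have hpos := h.setIntegral_gradTsq_sub_gpot_nonneg hω hω_bdd hPoincare
  have hJeq : ∫ x in Ioo m M ×ˢ ω, (gradTsq ψ x - gpot E₁ a l x.1 * (ψ x) ^ 2) =
      (∫ x in Ioo m M ×ˢ ω, gradTsq ψ x) - E₁ * ∫ x in Ioo m M ×ˢ ω, (ψ x) ^ 2 := by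
    rw [← integral_const_mul, ← integral_sub (hG.mono_set hsub)
      ((h.integrableOn_sq.mono_set hsub).const_mul E₁)]
    refine setIntegral_congr_fun hJ fun x hx => ?_
    have : x.1 ∉ Ioo a (a + l) := fun hx' => absurd (hx.1.2.trans_le hMa) hx'.1.le.not_gt
    simp only [gpot, if_neg this]
  have hJle : ∫ x in Ioo m M ×ˢ ω, (gradTsq ψ x - gpot E₁ a l x.1 * (ψ x) ^ 2) ≤
      (∫ x in (univ : Set ℝ) ×ˢ ω, gradTsq ψ x)
        - ∫ x in (univ : Set ℝ) ×ˢ ω, gpot E₁ a l x.1 * (ψ x) ^ 2 := by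
    have hunion : (univ : Set ℝ) ×ˢ ω = Ioo m M ×ˢ ω ∪ (Ioo m M)ᶜ ×ˢ ω := by
      rw [← union_prod, union_compl_self]
    have hdisj : Disjoint (Ioo m M ×ˢ ω) ((Ioo m M)ᶜ ×ˢ ω) :=
      disjoint_compl_right.set_prod_left _ _
    have hGg : IntegrableOn (fun x => gradTsq ψ x - gpot E₁ a l x.1 * (ψ x) ^ 2)
        ((univ : Set ℝ) ×ˢ ω) := hG.sub hgp
    rw [← integral_sub hG hgp, hunion, setIntegral_union hdisj
      (measurableSet_Ioo.compl.prod hω.measurableSet) (hGg.mono_set hsub)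
      (hGg.mono_set (prod_mono_left (subset_univ _)))]
    linarith [hpos (Ioo m M)ᶜ]
  have hJ0 := hpos (Ioo m M)
  rw [← hJeq] at hMixed
  have hγJ := mul_le_mul_of_nonneg_right hγ hJ0
  have hneg := (abs_le.1 hMixed).1
  rw [hexpand, hcross]
  linarith

end Admissible

lemma eq_zero_of_notMem_Ioo_tsupport {η : ℝ → ℝ} (hη : Continuous η)
    (hηc : HasCompactSupport η) {s : ℝ}
    (hs : s ∉ Ioo (sInf (tsupport η)) (sSup (tsupport η))) : η s = 0 := by
  by_contra hne
  have hsub : Function.support η ⊆ Icc (sInf (tsupport η)) (sSup (tsupport η)) := fun r hr =>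
    ⟨csInf_le hηc.isCompact.bddBelow (subset_tsupport η hr),
      le_csSup hηc.isCompact.bddAbove (subset_tsupport η hr)⟩
  have hint := interior_maximal hsub hη.isOpen_support
  rw [interior_Icc] at hint
  exact hs (hint hne)

/-- The smallness of the window, in the form needed to absorb the window mass. -/
lemma window_smallness {E₁ a p C K l : ℝ} (hE₁ : 0 < E₁) (hC : 0 < C) (hpa : p ≤ a)
    (hK : K = 1 / (π * C) + 4 * Real.log 2 / π + (a - p)) (hl : 0 < l)
    (hlmax : l ≤ -K + Real.sqrt (K ^ 2 + 1 / (4 * E₁))) :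
    E₁ * (8 * l / (π * C) + 4 * l * (a + l - p + 1)) ≤ 1 := by
  have hπ := Real.pi_pos
  have hlog := Real.log_two_gt_d9
  have hC' : 0 < 1 / (π * C) := by positivity
  have hlogπ : 1 / 2 ≤ 4 * Real.log 2 / π := by
    rw [le_div_iff₀ hπ]
    linarith [Real.pi_lt_four]
  have hK0 : 0 ≤ K := by linarith
  have hsq : (l + K) ^ 2 ≤ K ^ 2 + 1 / (4 * E₁) := by
    rw [← Real.sq_sqrt (show 0 ≤ K ^ 2 + 1 / (4 * E₁) by positivity)]
    exact pow_le_pow_left₀ (by linarith) (by linarith) 2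
  have h1 : 4 * E₁ * (l ^ 2 + 2 * l * K) ≤ 1 := by
    have h2 : l ^ 2 + 2 * l * K ≤ 1 / (4 * E₁) := by linarith
    rw [le_div_iff₀ (by positivity)] at h2
    linarith
  refine le_trans ?_ h1
  have h8 : 8 * l / (π * C) = l * (8 * (1 / (π * C))) := by ring
  have h3 : 8 * l / (π * C) + 4 * l * (a + l - p + 1) ≤ 4 * (l ^ 2 + 2 * l * K) := by
    have := mul_nonneg hl.le (show 0 ≤ 8 * K - 8 * (1 / (π * C)) - 4 * (a - p + 1) by linarith)
    rw [h8]
    linarith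
  calc _ ≤ E₁ * (4 * (l ^ 2 + 2 * l * K)) := mul_le_mul_of_nonneg_left h3 hE₁.le
    _ = _ := by ring

theorem stmt_15 (ω : Set (ℝ × ℝ)) (hω_open : IsOpen ω) (hω_bdd : Bornology.IsBounded ω)
    (hω_conn : IsConnected ω)
    (E₁ : ℝ) (hE₁ : 0 < E₁)
    (hPoincare : ∀ v : ℝ × ℝ → ℝ, TestFun ω v →
      (∫ t in ω, gradVsq v t) ≥ E₁ * ∫ t in ω, (v t) ^ 2)
    (θ : ℝ → ℝ) (hθ : ContDiff ℝ 1 θ) (hθc : HasCompactSupport θ)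
    (θm θM : ℝ) (hθm : θm = sInf (tsupport (deriv θ))) (hθM : θM = sSup (tsupport (deriv θ)))
    (a : ℝ) (ha : θM ≤ a) (p : ℝ) (hp : p ∈ Set.Ioo θm θM)
    (C : ℝ) (hC : 0 < C)
    -- (i) the local Hardy inequality, for each window length `l`
    (hHardy : ∀ l : ℝ, 0 < l → ∀ ψ : ℝ × ℝ × ℝ → ℝ, Admissible ω a l ψ →
      (∫ x in (Set.univ : Set ℝ) ×ˢ ω, gradTsq ψ x)
        + (∫ x in (Set.univ : Set ℝ) ×ˢ ω, (dS ψ x + deriv θ x.1 * dTau ψ x) ^ 2)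
        - (∫ x in (Set.univ : Set ℝ) ×ˢ ω, gpot E₁ a l x.1 * (ψ x) ^ 2)
      ≥ C * ∫ x in (Set.univ : Set ℝ) ×ˢ ω, rho p x.1 * (ψ x) ^ 2)
    (γ : ℝ) (hγ : γ ∈ Set.Ioc (0 : ℝ) 1)
    -- (ii) the mixed-term bound, for each window length `l`
    (hMixed : ∀ l : ℝ, 0 < l → ∀ ψ : ℝ × ℝ × ℝ → ℝ, Admissible ω a l ψ →
      |2 * ∫ x in Set.Ioo θm θM ×ˢ ω, dS ψ x * (deriv θ x.1 * dTau ψ x)|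
        ≤ γ * ((∫ x in Set.Ioo θm θM ×ˢ ω, gradTsq ψ x)
              - E₁ * ∫ x in Set.Ioo θm θM ×ˢ ω, (ψ x) ^ 2)
          + (1 / 2) * (∫ x in Set.Ioo θm θM ×ˢ ω, (dS ψ x) ^ 2)
          + (1 / 2) * ∫ x in Set.Ioo θm θM ×ˢ ω, (deriv θ x.1 * dTau ψ x) ^ 2)
    (K lmax : ℝ)
    (hK : K = 1 / (Real.pi * C) + 4 * Real.log 2 / Real.pi + (a - p))
    (hlmax : lmax = -K + Real.sqrt (K ^ 2 + 1 / (4 * E₁))) :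
    ∀ l : ℝ, 0 < l → l ≤ lmax →
      ∀ ψ : ℝ × ℝ × ℝ → ℝ, Admissible ω a l ψ →
        (∫ x in (Set.univ : Set ℝ) ×ˢ ω,
            (gradTsq ψ x + (dS ψ x + deriv θ x.1 * dTau ψ x) ^ 2))
          - E₁ * (∫ x in (Set.univ : Set ℝ) ×ˢ ω, (ψ x) ^ 2) ≥ 0 := by
  intro l hl hlle ψ hψ
  have hη : Continuous (deriv θ) := hθ.continuous_deriv le_rfl
  have hηc : HasCompactSupport (deriv θ) := hθc.deriv
  have hpa : p ≤ a := hp.2.le.trans ha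
  have hsupp : ∀ s ∉ Ioo θm θM, deriv θ s = 0 := fun s hs =>
    eq_zero_of_notMem_Ioo_tsupport hη hηc (by rwa [← hθm, ← hθM])
  have hhalf := hψ.half_integral_dS_sq_le hω_open hω_bdd hPoincare hη hηc hsupp ha hγ.2
    (hMixed l hl ψ hψ)
  have hhardy := hHardy l hl ψ hψ
  have hwin := hψ.setIntegral_window_le hω_open hpa hl
  have hsmall := window_smallness hE₁ hC hpa hK hl (hlmax ▸ hlle)
  have hΩ : MeasurableSet ((univ : Set ℝ) ×ˢ ω) := (isOpen_univ.prod hω_open).measurableSet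
  have hD := hψ.integrableOn_dS_sq
  have hX := hψ.integrableOn_dS_mul_twist hω_open hω_bdd hη hηc
  have hT := hψ.integrableOn_twist_sq hω_open hω_bdd hη hηc
  have hsq : IntegrableOn (fun x => (dS ψ x + deriv θ x.1 * dTau ψ x) ^ 2)
      ((univ : Set ℝ) ×ˢ ω) :=
    ((hD.add (hX.const_mul 2)).add hT).congr (ae_of_all _ fun x => by
      simp only [Pi.add_apply]
      ring)
  have hgpot : ∫ x in (univ : Set ℝ) ×ˢ ω, gpot E₁ a l x.1 * (ψ x) ^ 2 =
      E₁ * (∫ x in (univ : Set ℝ) ×ˢ ω, (ψ x) ^ 2)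
        - E₁ * ∫ x in Ioo a (a + l) ×ˢ ω, (ψ x) ^ 2 := by
    have hWm : MeasurableSet (Ioo a (a + l) ×ˢ ω) := (isOpen_Ioo.prod hω_open).measurableSet
    have hind : ∫ x in Ioo a (a + l) ×ˢ ω, (ψ x) ^ 2 =
        ∫ x in (univ : Set ℝ) ×ˢ ω, (Ioo a (a + l) ×ˢ ω).indicator (fun x => (ψ x) ^ 2) x := by
      rw [setIntegral_indicator hWm, inter_eq_right.2 (prod_mono_left (subset_univ _))]
    rw [hind, ← integral_const_mul, ← integral_const_mul,
      ← integral_sub (hψ.integrableOn_sq.const_mul E₁)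
        ((hψ.integrableOn_sq.indicator hWm).const_mul E₁)]
    refine setIntegral_congr_fun hΩ fun x hx => ?_
    by_cases hx1 : x.1 ∈ Ioo a (a + l)
    · simp only [gpot, if_pos hx1, indicator_of_mem (show x ∈ Ioo a (a + l) ×ˢ ω from ⟨hx1, hx.2⟩)]
      ring
    · simp only [gpot, if_neg hx1,
        indicator_of_notMem (show x ∉ Ioo a (a + l) ×ˢ ω from fun h => hx1 h.1)]
      ring
  rw [integral_add hψ.integrableOn_gradTsq hsq]
  set X := ∫ x in (univ : Set ℝ) ×ˢ ω, rho p x.1 * (ψ x) ^ 2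
  set D := ∫ x in (univ : Set ℝ) ×ˢ ω, (dS ψ x) ^ 2
  set W := ∫ x in Ioo a (a + l) ×ˢ ω, (ψ x) ^ 2
  set A := (∫ x in (univ : Set ℝ) ×ˢ ω, gradTsq ψ x)
        + (∫ x in (univ : Set ℝ) ×ˢ ω, (dS ψ x + deriv θ x.1 * dTau ψ x) ^ 2)
        - (∫ x in (univ : Set ℝ) ×ˢ ω, gpot E₁ a l x.1 * (ψ x) ^ 2) with hA
  have hD0 : 0 ≤ D := integral_nonneg fun _ => sq_nonneg _
  have hA0 : 0 ≤ A := by linarith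
  have hXle : X ≤ A / C := by
    rw [le_div_iff₀ hC]
    linarith
  have hWle : W ≤ (8 * l / (π * C) + 4 * l * (a + l - p + 1)) * A := by
    have hc1 : 8 * l / π * X ≤ 8 * l / π * (A / C) :=
      mul_le_mul_of_nonneg_left hXle (by positivity)
    have hc2 : 2 * l * (a + l - p + 1) * D ≤ 2 * l * (a + l - p + 1) * (2 * A) :=
      mul_le_mul_of_nonneg_left (by linarith)
        (mul_nonneg (by linarith) (by linarith))
    have hc3 : 8 * l / π * (A / C) = 8 * l / (π * C) * A := by
      field_simp
    linarith
  have hEW : E₁ * W ≤ A :=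
    calc E₁ * W ≤ E₁ * ((8 * l / (π * C) + 4 * l * (a + l - p + 1)) * A) :=
          mul_le_mul_of_nonneg_left hWle hE₁.le
      _ = E₁ * (8 * l / (π * C) + 4 * l * (a + l - p + 1)) * A := by ring
      _ ≤ 1 * A := mul_le_mul_of_nonneg_right hsmall hA0
      _ = A := one_mul A
  rw [hgpot] at hA
  linarith
end
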